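/- For every fixed integer d ≥ 0 there exists a constant C = C(d) > 0 such that for every odd prime p, every polynomial f over F_p of degree d, every nonprincipal multiplicative character χ modulo p, and all integers H, N with 0 ≤ H < H + N < p, one has |∑_{n=H+1}^{H+N} χ(n! mod p) · e_p(f(n))| ≤ C · N^{3/4} · p^{1/8} · (log p)^{1/4}. -/

import Mathlib

open Polynomial

/-- A determinant of polynomials of bounded degree has bounded degree. -/
lemma natDegree_det_le_card_mul {R n : Type*} [CommRing R] [Fintype n] [DecidableEq n]
    (M : Matrix n n R[X]) (B : ℕ) (h : ∀ i j, (M i j).natDegree ≤ B) :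
    M.det.natDegree ≤ Fintype.card n * B := by
  rw [Matrix.det_apply]
  refine natDegree_sum_le_of_forall_le _ _ fun σ _ => ?_
  refine (natDegree_smul_le _ _).trans ((natDegree_prod_le _ _).trans ?_)
  refine (Finset.sum_le_sum fun i _ => h _ _).trans ?_
  simp

/-- Artin-Schreier polynomials without roots are irreducible. -/
lemma irreducible_X_pow_sub_X_sub_C {K : Type*} [Field K] (p : ℕ) [Fact p.Prime] [CharP K p]
    (c : K) (hc : ∀ x : K, x ^ p - x ≠ c) : Irreducible (X ^ p - X - C c : K[X]) := by
  have hp := (Fact.out : p.Prime)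
  have hp1 : 1 < p := hp.one_lt
  have hdeg : (X ^ p - X - C c : K[X]).natDegree = p := by
    rw [natDegree_sub_C]
    exact FiniteField.X_pow_card_sub_X_natDegree_eq K hp1
  have hmon : (X ^ p - X - C c : K[X]).Monic := by
    rw [sub_sub]
    apply monic_X_pow_sub
    rw [degree_X_add_C]
    exact_mod_cast hp1
  rw [hmon.irreducible_iff_natDegree']
  refine ⟨fun h => by rw [h] at hdeg; simp at hdeg; omega, ?_⟩
  intro f g hf hg hfg hmem
  rw [hdeg, Finset.mem_Ioc] at hmem
  set s := g.natDegree
  have hsp : s < p := by omega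
  let L := AlgebraicClosure K
  let φ := algebraMap K L
  have : CharP L p := charP_of_injective_algebraMap φ.injective p
  have hsplit : (g.map φ).Splits := IsAlgClosed.splits _
  have hroot : ∀ θ ∈ (g.map φ).roots, θ ^ p - θ = φ c := by
    intro θ hθ
    have h0 : (g.map φ).eval θ = 0 := (mem_roots'.mp hθ).2
    have : ((X ^ p - X - C c : K[X]).map φ).eval θ = 0 := by
      rw [← hfg, Polynomial.map_mul, eval_mul, h0, mul_zero]
    simpa [sub_eq_zero] using this
  have hsum : ((g.map φ).roots.sum) ^ p - (g.map φ).roots.sum = s * φ c := by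
    have hcard : Multiset.card (g.map φ).roots = s := by
      rw [← hsplit.natDegree_eq_card_roots, natDegree_map]
    have : ∀ m : Multiset L, (∀ θ ∈ m, θ ^ p - θ = φ c) →
        m.sum ^ p - m.sum = (Multiset.card m : L) * φ c := by
      intro m
      induction m using Multiset.induction_on with
      | empty => simp [hp.ne_zero]
      | cons a m ih =>
        intro h
        have h1 := h a (by simp)
        have h2 := ih fun θ hθ => h θ (by simp [hθ])
        rw [Multiset.sum_cons, add_pow_char, Multiset.card_cons]
        push_cast
        linear_combination h1 + h2
    rw [this _ hroot, hcard]
  have hnext : (g.map φ).roots.sum = φ (-g.nextCoeff) := by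
    have := hsplit.nextCoeff_eq_neg_sum_roots_of_monic (hg.map φ)
    rw [nextCoeff_map φ.injective] at this
    rw [map_neg, this, neg_neg]
  rw [hnext] at hsum
  have hK : (-g.nextCoeff) ^ p - (-g.nextCoeff) = s * c := by
    apply φ.injective
    simpa using hsum
  have hs0 : (s : K) ≠ 0 := by
    rw [Ne, CharP.cast_eq_zero_iff K p]
    exact fun h => absurd (Nat.le_of_dvd hmem.1 h) (by omega)
  have hsp' : (s : K) ^ p = s := by
    have := map_natCast (frobenius K p) s
    rwa [frobenius_def] at this
  refine hc (-g.nextCoeff / s) ?_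
  rw [div_pow, hsp', ← sub_div, hK]
  field_simp

/-- Existence of an extension of degree `n * p` obtained by adjoining a root of `X ^ n - G`
and a root of `X ^ p - X - H`. -/
lemma exists_kummer_artinSchreier_extension {R : Type} [CommRing R] [IsDomain R]
    [IsIntegrallyClosed R] (p : ℕ) [Fact p.Prime] [CharP R p] (n : ℕ) (hn : 0 < n) (hnp : n < p)
    (G H : R) (hG : Irreducible (X ^ n - C G : R[X])) (hH : ∀ x : R, x ^ p - x ≠ H) :
    ∃ (E : Type) (_ : Field E) (φ : R →+* E) (a b : E), a ^ n = φ G ∧ b ^ p = b + φ H ∧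
      ∀ c : Fin n × Fin p → R, ∑ i, φ (c i) * (a ^ (i.1 : ℕ) * b ^ (i.2 : ℕ)) = 0 → c = 0 := by
  have hp := (Fact.out : p.Prime)
  let F := FractionRing R
  have : CharP F p := charP_of_injective_algebraMap (IsFractionRing.injective R F) p
  have hGmon : (X ^ n - C G : R[X]).Monic := monic_X_pow_sub_C G hn.ne'
  have hGF : Irreducible (X ^ n - C (algebraMap R F G) : F[X]) := by
    have := (hGmon.irreducible_iff_irreducible_map_fraction_map (K := F)).mp hG
    simpa using this
  have : Fact (Irreducible (X ^ n - C (algebraMap R F G) : F[X])) := ⟨hGF⟩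
  have hHF : ∀ x : F, x ^ p - x ≠ algebraMap R F H := by
    intro x hx
    have hint : IsIntegral R x := by
      refine ⟨X ^ p - X - C H, ?_, ?_⟩
      · rw [sub_sub]
        apply monic_X_pow_sub
        rw [degree_X_add_C]
        exact_mod_cast hp.one_lt
      · simp [← hx]
    obtain ⟨y, hy⟩ := IsIntegrallyClosed.isIntegral_iff.mp hint
    refine hH y (IsFractionRing.injective R F ?_)
    rw [map_sub, map_pow, hy, hx]
  have hASF := irreducible_X_pow_sub_X_sub_C p (algebraMap R F H) hHF
  let E₁ := AdjoinRoot (X ^ n - C (algebraMap R F G) : F[X])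
  have hdegG : (X ^ n - C (algebraMap R F G) : F[X]).natDegree = n := natDegree_X_pow_sub_C
  let pb₁ := AdjoinRoot.powerBasis hGF.ne_zero
  have : FiniteDimensional F E₁ := pb₁.finite
  have : CharP E₁ p := charP_of_injective_algebraMap (algebraMap F E₁).injective p
  have hfin : Module.finrank F E₁ = n := by
    rw [pb₁.finrank, AdjoinRoot.powerBasis_dim, hdegG]
  have hHE : ∀ x : E₁, x ^ p - x ≠ algebraMap F E₁ (algebraMap R F H) := by
    intro x hx
    have hmin : (X ^ p - X - C (algebraMap R F H) : F[X]) = minpoly F x := by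
      apply minpoly.eq_of_irreducible_of_monic hASF
      · simp [hx]
      · rw [sub_sub]
        apply monic_X_pow_sub
        rw [degree_X_add_C]
        exact_mod_cast hp.one_lt
    have hle := minpoly.natDegree_le (A := F) x
    rw [← hmin, hfin, natDegree_sub_C, FiniteField.X_pow_card_sub_X_natDegree_eq F hp.one_lt] at hle
    omega
  have hASE := irreducible_X_pow_sub_X_sub_C p _ hHE
  set Q : E₁[X] := X ^ p - X - C (algebraMap F E₁ (algebraMap R F H)) with hQ
  have : Fact (Irreducible Q) := ⟨hASE⟩
  have hdegQ : Q.natDegree = p := by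
    rw [hQ, natDegree_sub_C]
    exact FiniteField.X_pow_card_sub_X_natDegree_eq E₁ hp.one_lt
  let E := AdjoinRoot Q
  let pb₂ := AdjoinRoot.powerBasis hASE.ne_zero
  let a₁ : E₁ := AdjoinRoot.root _
  refine ⟨E, inferInstance, (algebraMap E₁ E).comp ((algebraMap F E₁).comp (algebraMap R F)),
    algebraMap E₁ E a₁, AdjoinRoot.root Q, ?_, ?_, ?_⟩
  · have h1 : a₁ ^ n = algebraMap F E₁ (algebraMap R F G) := by
      have := AdjoinRoot.eval₂_root (X ^ n - C (algebraMap R F G) : F[X])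
      simp only [eval₂_sub, eval₂_pow, eval₂_X, eval₂_C, sub_eq_zero] at this
      exact this
    rw [← map_pow, h1]
    rfl
  · have := AdjoinRoot.eval₂_root Q
    rw [hQ] at this
    simp only [eval₂_sub, eval₂_pow, eval₂_X, eval₂_C, sub_sub, sub_eq_zero, eval₂_add] at this
    exact this
  · intro c hc
    have hli₂ : ∀ d : Fin p → E₁, ∑ l, algebraMap E₁ E (d l) * AdjoinRoot.root Q ^ (l : ℕ) = 0 →
        d = 0 := by
      intro d hd
      have hpb : pb₂.dim = p := by rw [AdjoinRoot.powerBasis_dim, hdegQ]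
      have := Fintype.linearIndependent_iff.mp pb₂.basis.linearIndependent
        (fun i => d (Fin.cast hpb i)) (by
          rw [← hd]
          refine Fintype.sum_equiv (finCongr hpb) _ _ fun i => ?_
          simp [pb₂, Algebra.smul_def]
          exact Or.inl rfl)
      ext l
      simpa using this (Fin.cast hpb.symm l)
    have hli₁ : ∀ d : Fin n → F, ∑ k, algebraMap F E₁ (d k) * a₁ ^ (k : ℕ) = 0 → d = 0 := by
      intro d hd
      have hpb : pb₁.dim = n := by rw [AdjoinRoot.powerBasis_dim, hdegG]
      have := Fintype.linearIndependent_iff.mp pb₁.basis.linearIndependent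
        (fun i => d (Fin.cast hpb i)) (by
          rw [← hd]
          refine Fintype.sum_equiv (finCongr hpb) _ _ fun i => ?_
          simp [pb₁, Algebra.smul_def, a₁]
          exact Or.inl rfl)
      ext l
      simpa using this (Fin.cast hpb.symm l)
    have h2 := hli₂ (fun l => ∑ k, algebraMap F E₁ (algebraMap R F (c (k, l))) * a₁ ^ (k : ℕ)) (by
      rw [← hc, Fintype.sum_prod_type_right]
      refine Finset.sum_congr rfl fun l _ => ?_
      rw [map_sum, Finset.sum_mul]
      refine Finset.sum_congr rfl fun k _ => ?_
      simp [mul_assoc])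
    ext ⟨k, l⟩
    have h1 := hli₁ (fun k => algebraMap R F (c (k, l))) (congrFun h2 l)
    exact IsFractionRing.injective R F (by simpa using congrFun h1 k)

/-- The matrix of multiplication by `a` in the basis `a ^ k * b ^ l`, where `a ^ n = G`. -/
def kummerMatrix {R : Type*} [CommRing R] (n p : ℕ) (G : R) :
    Matrix (Fin n × Fin p) (Fin n × Fin p) R :=
  fun i j => if i.2 = j.2 then
    (if (j.1 : ℕ) + 1 < n then (if (i.1 : ℕ) = j.1 + 1 then 1 else 0)
      else (if (i.1 : ℕ) = 0 then G else 0)) else 0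

/-- The matrix of multiplication by `b` in the basis `a ^ k * b ^ l`, where `b ^ p = b + H`. -/
def artinSchreierMatrix {R : Type*} [CommRing R] (n p : ℕ) (H : R) :
    Matrix (Fin n × Fin p) (Fin n × Fin p) R :=
  fun i j => if i.1 = j.1 then
    (if (j.2 : ℕ) + 1 < p then (if (i.2 : ℕ) = j.2 + 1 then 1 else 0)
      else (if (i.2 : ℕ) = 0 then H else if (i.2 : ℕ) = 1 then 1 else 0)) else 0

/-- The matrix of multiplication by `∑ c (k, l) * a ^ k * b ^ l`. -/
def towerMatrix {R : Type*} [CommRing R] (n p : ℕ) (G H : R) (c : Fin n × Fin p → R) :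
    Matrix (Fin n × Fin p) (Fin n × Fin p) R :=
  ∑ i, c i • (kummerMatrix n p G ^ (i.1 : ℕ) * artinSchreierMatrix n p H ^ (i.2 : ℕ))

lemma vecMul_kummerMatrix {R : Type*} [CommRing R] (n p : ℕ) (a b G : R) (ha : a ^ n = G) :
    Matrix.vecMul (fun i : Fin n × Fin p => a ^ (i.1 : ℕ) * b ^ (i.2 : ℕ)) (kummerMatrix n p G) =
      a • fun i : Fin n × Fin p => a ^ (i.1 : ℕ) * b ^ (i.2 : ℕ) := by
  ext ⟨k, l⟩
  simp only [Matrix.vecMul, dotProduct, kummerMatrix, Fintype.sum_prod_type, mul_ite, mul_zero,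
    Finset.sum_ite_eq', Finset.mem_univ, if_true, Pi.smul_apply, smul_eq_mul]
  have hk := k.2
  by_cases h : (k : ℕ) + 1 < n
  · simp only [h, if_true]
    rw [Finset.sum_eq_single (⟨k + 1, h⟩ : Fin n)]
    · simp; ring
    · intro i _ hi
      rw [if_neg fun h' => hi (Fin.ext h')]
    · simp
  · simp only [h, if_false]
    rw [Finset.sum_eq_single (⟨0, by omega⟩ : Fin n)]
    · have : n = k + 1 := by omega
      have h2 : a ^ n = a ^ ((k : ℕ) + 1) := by rw [← this]
      simp only [if_true, pow_zero, one_mul, ← ha, h2]; ring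
    · intro i _ hi
      rw [if_neg fun h' => hi (Fin.ext h')]
    · simp

lemma vecMul_artinSchreierMatrix {R : Type*} [CommRing R] (n p : ℕ) (hp : 2 ≤ p) (a b H : R)
    (hb : b ^ p = b + H) :
    Matrix.vecMul (fun i : Fin n × Fin p => a ^ (i.1 : ℕ) * b ^ (i.2 : ℕ))
      (artinSchreierMatrix n p H) =
      b • fun i : Fin n × Fin p => a ^ (i.1 : ℕ) * b ^ (i.2 : ℕ) := by
  ext ⟨k, l⟩
  simp only [Matrix.vecMul, dotProduct, artinSchreierMatrix, Fintype.sum_prod_type_right, mul_ite,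
    mul_zero, Finset.sum_ite_eq', Finset.mem_univ, if_true, Pi.smul_apply, smul_eq_mul]
  have hl := l.2
  by_cases h : (l : ℕ) + 1 < p
  · simp only [h, if_true]
    rw [Finset.sum_eq_single (⟨l + 1, h⟩ : Fin p)]
    · simp; ring
    · intro i _ hi
      rw [if_neg fun h' => hi (Fin.ext h')]
    · simp
  · simp only [h, if_false]
    rw [Finset.sum_eq_add (⟨0, by omega⟩ : Fin p) (⟨1, by omega⟩ : Fin p)]
    · have : p = l + 1 := by omega
      have h2 : b ^ ((l : ℕ) + 1) = b + H := by rw [← this, hb]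
      rw [pow_succ] at h2
      simp only [if_true, pow_zero, one_ne_zero, if_false, pow_one, mul_one]
      linear_combination -(a ^ (k : ℕ)) * h2
    · simp
    · intro i _ hi
      rw [if_neg fun h' => hi.1 (Fin.ext h'), if_neg fun h' => hi.2 (Fin.ext h')]
    · simp
    · simp

lemma vecMul_pow_eq_smul {R ι : Type*} [CommRing R] [Fintype ι] [DecidableEq ι]
    (v : ι → R) (M : Matrix ι ι R) (a : R) (h : Matrix.vecMul v M = a • v) (k : ℕ) :
    Matrix.vecMul v (M ^ k) = a ^ k • v := by
  induction k with
  | zero => simp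
  | succ k ih =>
    rw [pow_succ, ← Matrix.vecMul_vecMul, ih, Matrix.smul_vecMul, h, smul_smul, pow_succ]

lemma vecMul_towerMatrix {R : Type*} [CommRing R] (n p : ℕ) (hp : 2 ≤ p) (a b G H : R)
    (ha : a ^ n = G) (hb : b ^ p = b + H) (c : Fin n × Fin p → R) :
    Matrix.vecMul (fun i : Fin n × Fin p => a ^ (i.1 : ℕ) * b ^ (i.2 : ℕ))
      (towerMatrix n p G H c) =
      (∑ i, c i * (a ^ (i.1 : ℕ) * b ^ (i.2 : ℕ))) •
        fun i : Fin n × Fin p => a ^ (i.1 : ℕ) * b ^ (i.2 : ℕ) := by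
  rw [towerMatrix, Matrix.vecMul_sum, Finset.sum_smul]
  refine Finset.sum_congr rfl fun i _ => ?_
  rw [Matrix.vecMul_smul, ← Matrix.vecMul_vecMul,
    vecMul_pow_eq_smul _ _ _ (vecMul_kummerMatrix n p a b G ha), Matrix.smul_vecMul,
    vecMul_pow_eq_smul _ _ _ (vecMul_artinSchreierMatrix n p hp a b H hb), smul_smul, smul_smul,
    mul_assoc]

lemma map_towerMatrix {R S : Type*} [CommRing R] [CommRing S] (φ : R →+* S) (n p : ℕ) (G H : R)
    (c : Fin n × Fin p → R) :
    φ.mapMatrix (towerMatrix n p G H c) = towerMatrix n p (φ G) (φ H) (fun i => φ (c i)) := by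
  have h1 : φ.mapMatrix (kummerMatrix n p G) = kummerMatrix n p (φ G) := by
    ext i j
    simp only [kummerMatrix, RingHom.mapMatrix_apply, Matrix.map_apply]
    split_ifs <;> simp
  have h2 : φ.mapMatrix (artinSchreierMatrix n p H) = artinSchreierMatrix n p (φ H) := by
    ext i j
    simp only [artinSchreierMatrix, RingHom.mapMatrix_apply, Matrix.map_apply]
    split_ifs <;> simp
  simp only [towerMatrix, map_sum]
  refine Finset.sum_congr rfl fun i _ => ?_
  rw [← h1, ← h2, ← map_pow, ← map_pow, ← map_mul]
  ext
  simp only [RingHom.mapMatrix_apply, Matrix.map_apply, Matrix.smul_apply, smul_eq_mul,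
    _root_.map_mul φ]

/-- If `∑ c (k, l) * a ^ k * b ^ l` vanishes in some specialization, then so does the norm of the
generic such element. -/
lemma map_det_towerMatrix_eq_zero {R S : Type*} [CommRing R] [CommRing S] [IsDomain S]
    (φ : R →+* S) (n p : ℕ) (hn : 0 < n) (hp : 2 ≤ p) (G H : R) (a b : S) (ha : a ^ n = φ G)
    (hb : b ^ p = b + φ H) (c : Fin n × Fin p → R)
    (h : ∑ i, φ (c i) * (a ^ (i.1 : ℕ) * b ^ (i.2 : ℕ)) = 0) :
    φ (towerMatrix n p G H c).det = 0 := by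
  rw [RingHom.map_det, map_towerMatrix, ← Matrix.exists_vecMul_eq_zero_iff]
  refine ⟨_, ?_, (vecMul_towerMatrix n p hp a b _ _ ha hb _).trans (by rw [h, zero_smul])⟩
  intro h0
  have := congrFun h0 (⟨0, hn⟩, ⟨0, by omega⟩)
  simp at this

lemma det_towerMatrix_ne_zero {R : Type} [CommRing R] [IsDomain R]
    [IsIntegrallyClosed R] (p : ℕ) [Fact p.Prime] [CharP R p] (n : ℕ) (hn : 0 < n) (hnp : n < p)
    (G H : R) (hG : Irreducible (X ^ n - C G : R[X])) (hH : ∀ x : R, x ^ p - x ≠ H)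
    (c : Fin n × Fin p → R) (hc : c ≠ 0) : (towerMatrix n p G H c).det ≠ 0 := by
  obtain ⟨E, _, φ, a, b, ha, hb, hli⟩ := exists_kummer_artinSchreier_extension p n hn hnp G H hG hH
  intro hdet
  obtain ⟨v, hv, hv0⟩ := Matrix.exists_mulVec_eq_zero_iff.mpr hdet
  have hp : p.Prime := Fact.out
  have h1 := vecMul_towerMatrix n p hp.two_le a b (φ G) (φ H) ha hb (fun i => φ (c i))
  rw [← map_towerMatrix] at h1
  have h2 : Matrix.mulVec (φ.mapMatrix (towerMatrix n p G H c)) (fun i => φ (v i)) = 0 := by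
    ext i
    have := congrArg φ (congrFun hv0 i)
    simpa [Matrix.mulVec, dotProduct] using this
  have h3 := congrArg (fun w => dotProduct w (fun i => φ (v i))) h1
  simp only [smul_dotProduct] at h3
  rw [← Matrix.dotProduct_mulVec, h2, dotProduct_zero] at h3
  rcases smul_eq_zero.mp h3.symm with h | h
  · exact hc (hli c h)
  · refine hv (hli v ?_)
    rw [← h]
    simp [dotProduct, mul_comm]

lemma natDegree_matrix_mul_le {R ι : Type*} [CommRing R] [Fintype ι] (M N : Matrix ι ι R[X])
    (a b : ℕ) (hM : ∀ i j, (M i j).natDegree ≤ a) (hN : ∀ i j, (N i j).natDegree ≤ b) (i j : ι) :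
    ((M * N) i j).natDegree ≤ a + b := by
  rw [Matrix.mul_apply]
  exact natDegree_sum_le_of_forall_le _ _ fun k _ => natDegree_mul_le_of_le (hM i k) (hN k j)

lemma natDegree_matrix_pow_le {R ι : Type*} [CommRing R] [Fintype ι] [DecidableEq ι]
    (M : Matrix ι ι R[X]) (a : ℕ) (hM : ∀ i j, (M i j).natDegree ≤ a) (k : ℕ) (i j : ι) :
    ((M ^ k) i j).natDegree ≤ k * a := by
  induction k generalizing i j with
  | zero =>
    rw [pow_zero, Matrix.one_apply]
    split_ifs <;> simp
  | succ k ih =>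
    rw [pow_succ, add_mul, one_mul]
    exact natDegree_matrix_mul_le _ _ _ _ ih hM i j

lemma natDegree_det_towerMatrix_le {R : Type*} [CommRing R] (n p : ℕ) (G H : R[X])
    (c : Fin n × Fin p → R[X]) (D : ℕ) (hc : ∀ i, (c i).natDegree ≤ D) :
    (towerMatrix n p G H c).det.natDegree ≤
      n * p * (D + (n * G.natDegree + p * H.natDegree)) := by
  have h := natDegree_det_le_card_mul (towerMatrix n p G H c)
    (D + (n * G.natDegree + p * H.natDegree)) ?_
  · simpa using h
  intro i j
  rw [towerMatrix, Matrix.sum_apply]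
  refine natDegree_sum_le_of_forall_le _ _ fun k _ => ?_
  rw [Matrix.smul_apply, smul_eq_mul]
  refine natDegree_mul_le_of_le (hc k) (natDegree_matrix_mul_le _ _ _ _ ?_ ?_ i j)
  · intro i j
    refine (natDegree_matrix_pow_le _ G.natDegree ?_ _ i j).trans
      (Nat.mul_le_mul_right _ k.1.2.le)
    intro i j
    simp only [kummerMatrix]
    split_ifs <;> simp
  · intro i j
    refine (natDegree_matrix_pow_le _ H.natDegree ?_ _ i j).trans
      (Nat.mul_le_mul_right _ k.2.2.le)
    intro i j
    simp only [artinSchreierMatrix]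
    split_ifs <;> simp

/-- The specialization `P(Z, X) ↦ P(X ^ q, X)`, where `X` is the outer variable. -/
noncomputable def powSpecialization (F : Type*) [CommRing F] (q : ℕ) : F[X][X] →+* F[X] :=
  eval₂RingHom (expand F q : F[X] →+* F[X]) X

lemma powSpecialization_C {F : Type*} [CommRing F] (q : ℕ) (f : F[X]) :
    powSpecialization F q (C f) = expand F q f := by
  simp [powSpecialization]

lemma powSpecialization_map_C {F : Type*} [CommRing F] (q : ℕ) (f : F[X]) :
    powSpecialization F q (f.map C) = f := by
  simp only [powSpecialization, coe_eval₂RingHom, eval₂_map]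
  have : ((expand F q : F[X] →+* F[X])).comp C = C := by ext; simp
  rw [this, eval₂_C_X]

lemma powSpecialization_ne_zero {F : Type*} [CommRing F] (q : ℕ) (P : F[X][X]) (hP : P ≠ 0)
    (hq : P.natDegree < q) : powSpecialization F q P ≠ 0 := by
  intro h0
  refine hP (Polynomial.ext fun i => Polynomial.ext fun m => ?_)
  rw [coeff_zero, coeff_zero]
  by_cases hi : i < q
  swap
  · rw [coeff_eq_zero_of_natDegree_lt (hq.trans_le (not_lt.mp hi)), coeff_zero]
  have h1 : powSpecialization F q P = ∑ j ∈ Finset.range q, expand F q (P.coeff j) * X ^ j := by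
    rw [powSpecialization, coe_eval₂RingHom, eval₂_eq_sum_range' _ hq]
    rfl
  have h2 := congrArg (fun r => r.coeff (m * q + i)) (h1.symm.trans h0)
  simp only [finsetSum_coeff, coeff_zero, coeff_mul_X_pow'] at h2
  rw [Finset.sum_eq_single i] at h2
  · rwa [if_pos (by omega), Nat.add_sub_cancel, coeff_expand_mul (by omega)] at h2
  · intro j hj hji
    rw [Finset.mem_range] at hj
    split_ifs with hle
    · rw [coeff_expand (by omega), if_neg]
      rintro ⟨t, ht⟩
      have h3 : m * q + i = q * t + j := by omega
      have h4 := congrArg (· % q) h3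
      simp only [Nat.mul_add_mod, mul_comm m q, Nat.mod_eq_of_lt hj, Nat.mod_eq_of_lt hi] at h4
      exact hji h4.symm
    · rfl
  · intro h
    exact absurd (Finset.mem_range.mpr hi) h

lemma ZMod.expand_pow_card {p : ℕ} [Fact p.Prime] (m : ℕ) (f : (ZMod p)[X]) :
    expand (ZMod p) (p ^ m) f = f ^ p ^ m := by
  induction m with
  | zero => simp
  | succ m ih => rw [pow_succ, mul_comm, expand_mul, ih, ZMod.expand_card, ← pow_mul, mul_comm]

lemma irreducible_kummer_polynomial {F : Type*} [Field F] (n : ℕ) (hn : 0 < n) (g₁ : F[X]) (α : F)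
    (hα : g₁.eval α ≠ 0) :
    Irreducible (X ^ n - C (C ((X - C α) * g₁) * (((X - C α) * g₁).map C) ^ (n - 1)) :
      F[X][X][X]) := by
  set g := (X - C α) * g₁ with hg
  set G : F[X][X] := C g * (g.map C) ^ (n - 1)
  set ϖ : F[X] := X - C α
  have hϖ : Prime (C ϖ : F[X][X]) := prime_C_iff.mpr (prime_X_sub_C α)
  have hmon : (X ^ n - C G).Monic := monic_X_pow_sub_C G hn.ne'
  have hg0 : g ≠ 0 := mul_ne_zero (X_sub_C_ne_zero α) fun h => hα (by simp [h])
  have hdG : C ϖ ∣ G := Dvd.dvd.mul_right (by rw [hg, C_mul]; exact dvd_mul_right _ _) _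
  refine irreducible_of_eisenstein_criterion (P := Ideal.span {C ϖ})
    ((Ideal.span_singleton_prime hϖ.ne_zero).mpr hϖ) ?_ ?_ ?_ ?_ hmon.isPrimitive
  · rw [hmon.leadingCoeff, Ideal.mem_span_singleton]
    exact fun h => hϖ.not_isUnit (isUnit_of_dvd_one h)
  · intro k hk
    rw [degree_X_pow_sub_C hn] at hk
    have hk' : k < n := by exact_mod_cast hk
    rw [coeff_sub, coeff_X_pow, if_neg hk'.ne, zero_sub, coeff_C, Ideal.mem_span_singleton]
    split_ifs
    · exact (dvd_neg).mpr hdG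
    · simp
  · rw [degree_X_pow_sub_C hn]; exact_mod_cast hn
  · rw [coeff_sub, coeff_X_pow, if_neg hn.ne, zero_sub, coeff_C_zero, Ideal.span_singleton_pow,
      Ideal.mem_span_singleton]
    intro h
    replace h : C ϖ ^ 2 ∣ G := (dvd_neg (α := F[X][X])).mp h
    have hG : G = C ϖ * (C g₁ * (g.map C) ^ (n - 1)) := by
      simp only [G, hg, C_mul, mul_assoc, ϖ]
    rw [hG, pow_two, mul_dvd_mul_iff_left hϖ.ne_zero] at h
    rcases hϖ.dvd_or_dvd h with h | h
    · have h' : ϖ ∣ g₁ := by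
        have := (C_dvd_iff_dvd_coeff _ _).mp h 0
        simpa using this
      exact hα (dvd_iff_isRoot.mp h')
    · have h := hϖ.dvd_of_dvd_pow h
      refine hg0 (Polynomial.ext fun i => ?_)
      have := (C_dvd_iff_dvd_coeff _ _).mp h i
      rw [coeff_map, dvd_iff_isRoot] at this
      simpa using this

lemma artinSchreier_ne {F : Type*} [Field F] (p : ℕ) (h : F[X]) (hh : 0 < h.natDegree)
    (hhp : h.natDegree < p) (x : F[X][X]) : x ^ p - x ≠ C h - h.map C := by
  intro hx
  have h1 := congrArg (eval 0) hx
  rw [eval_sub, eval_sub, eval_pow, eval_C, eval_zero_map] at h1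
  set y := x.eval 0
  have h2 : (y ^ p - y).natDegree = h.natDegree := by rw [h1, natDegree_sub_C]
  rcases Nat.eq_zero_or_pos y.natDegree with h0 | h0
  · have : (y ^ p - y).natDegree ≤ 0 := (natDegree_sub_le _ _).trans (by simp [natDegree_pow, h0])
    omega
  · have h3 : y.natDegree < (y ^ p).natDegree := by
      rw [natDegree_pow]; nlinarith
    rw [natDegree_sub_eq_left_of_natDegree_lt h3, natDegree_pow] at h2
    nlinarith

/-- Independence of the products `A ^ k * B ^ l` over polynomials in `X` and `X ^ q` of small
degree in `X`, where `A ^ (p - 1) = g ^ (q - 1)` and `B ^ p - B = h ^ q - h`. -/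
lemma sum_mul_pow_mul_pow_ne_zero (p : ℕ) [Fact p.Prime] (hp2 : 2 < p) (g₁ h : (ZMod p)[X])
    (α : ZMod p) (hα : g₁.eval α ≠ 0) (hh : 0 < h.natDegree) (hhp : h.natDegree < p) :
    ∃ K : ℕ, ∀ m D : ℕ, (p - 1) * p * (D + K) < p ^ m → ∀ A B : (ZMod p)[X],
      A ^ (p - 1) = ((X - C α) * g₁) ^ (p ^ m - 1) → B ^ p = B + (h ^ p ^ m - h) →
      ∀ c : Fin (p - 1) × Fin p → (ZMod p)[X][X], (∀ i, (c i).natDegree ≤ D) → c ≠ 0 →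
      ∑ i, powSpecialization _ (p ^ m) (c i) * (A ^ (i.1 : ℕ) * B ^ (i.2 : ℕ)) ≠ 0 := by
  set g := (X - C α) * g₁ with hg
  set n := p - 1 with hn
  have hg0 : g ≠ 0 := mul_ne_zero (X_sub_C_ne_zero α) fun h => hα (by simp [h])
  set G : (ZMod p)[X][X] := C g * (g.map C) ^ (n - 1) with hG
  set H : (ZMod p)[X][X] := C h - h.map C with hH
  refine ⟨n * g.natDegree + (n * G.natDegree + p * H.natDegree), ?_⟩
  intro m D hD A B hA hB c hc hc0 hzero
  set σ := powSpecialization (ZMod p) (p ^ m) with hσ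
  set c' : Fin n × Fin p → (ZMod p)[X][X] := fun i => c i * (g.map C) ^ (n - 1 - i.1) with hc'
  have hgC : g.map C ≠ 0 := (Polynomial.map_ne_zero_iff C_injective).mpr hg0
  have hc'0 : c' ≠ 0 := by
    intro h0
    refine hc0 (funext fun i => ?_)
    have := congrFun h0 i
    exact (mul_eq_zero.mp this).resolve_right (pow_ne_zero _ hgC)
  have hdet := det_towerMatrix_ne_zero p n (by omega) (by omega) G H
    (irreducible_kummer_polynomial n (by omega) g₁ α hα) (artinSchreier_ne p h hh hhp) c' hc'0
  refine powSpecialization_ne_zero (p ^ m) _ hdet ?_ ?_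
  · refine (natDegree_det_towerMatrix_le n p G H c' (D + n * g.natDegree) ?_).trans_lt ?_
    · intro i
      refine natDegree_mul_le_of_le (hc i) (natDegree_pow_le.trans ?_)
      rw [natDegree_map_eq_of_injective C_injective]
      exact Nat.mul_le_mul_right _ (by omega)
    · rwa [add_assoc]
  · refine map_det_towerMatrix_eq_zero σ n p (by omega) (by omega) G H (g * A) B ?_ ?_ c' ?_
    · rw [mul_pow, hA, hG, map_mul, map_pow, hσ, powSpecialization_C, powSpecialization_map_C,
        ZMod.expand_pow_card, ← pow_add, ← pow_add]
      congr 1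
      have : 0 < p ^ m := pow_pos (by omega) m
      omega
    · rw [hB, hH, map_sub, hσ, powSpecialization_C, powSpecialization_map_C,
        ZMod.expand_pow_card]
    · rw [← mul_zero (g ^ (n - 1)), ← hzero, Finset.mul_sum]
      refine Finset.sum_congr rfl fun i _ => ?_
      have hi := i.1.2
      have h5 : g ^ (n - 1) = g ^ (n - 1 - (i.1 : ℕ)) * g ^ (i.1 : ℕ) := by
        rw [← pow_add]; congr 1; omega
      simp only [hc', map_mul, map_pow]
      rw [hσ, powSpecialization_map_C, h5, mul_pow]
      ring_nf

/-- The ring homomorphism `f ↦ f (x + T)`, with `T` the outer variable. -/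
noncomputable def translateHom (F : Type*) [CommRing F] : F[X] →+* F[X][X] :=
  eval₂RingHom (C.comp C) (X + C X)

lemma natDegree_coeff_mul_le {F : Type*} [CommRing F] {P P' : F[X][X]} {a b : ℕ}
    (hP : ∀ s, (P.coeff s).natDegree ≤ a) (hP' : ∀ s, (P'.coeff s).natDegree ≤ b) (s : ℕ) :
    ((P * P').coeff s).natDegree ≤ a + b := by
  rw [coeff_mul]
  exact natDegree_sum_le_of_forall_le _ _ fun k _ => natDegree_mul_le_of_le (hP _) (hP' _)

lemma natDegree_coeff_pow_le {F : Type*} [CommRing F] {P : F[X][X]} {a : ℕ}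
    (hP : ∀ s, (P.coeff s).natDegree ≤ a) (k s : ℕ) :
    ((P ^ k).coeff s).natDegree ≤ k * a := by
  induction k generalizing s with
  | zero =>
    rw [pow_zero, coeff_one]
    split_ifs <;> simp
  | succ k ih =>
    rw [pow_succ, add_mul, one_mul]
    exact natDegree_coeff_mul_le ih hP s

lemma natDegree_coeff_C_le {F : Type*} [CommRing F] (f : F[X]) (s : ℕ) :
    ((C f : F[X][X]).coeff s).natDegree ≤ f.natDegree := by
  rw [coeff_C]
  split_ifs <;> simp

lemma natDegree_coeff_translateHom_le {F : Type*} [CommRing F] (f : F[X]) (s : ℕ) :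
    ((translateHom F f).coeff s).natDegree ≤ f.natDegree := by
  rw [translateHom, coe_eval₂RingHom, eval₂_eq_sum_range, finsetSum_coeff]
  refine natDegree_sum_le_of_forall_le _ _ fun k hk => ?_
  rw [Finset.mem_range] at hk
  have hX : ∀ s, ((X + C X : F[X][X]).coeff s).natDegree ≤ 1 := by
    intro s
    rw [coeff_add, coeff_X, coeff_C]
    refine natDegree_add_le_of_degree_le ?_ ?_ <;> split_ifs <;> simp [natDegree_X_le]
  refine (natDegree_coeff_mul_le (a := 0) (b := k * 1) ?_ (natDegree_coeff_pow_le hX k) s).trans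
    (by omega)
  intro s
  exact (natDegree_coeff_C_le _ s).trans (by simp)

lemma X_pow_dvd_pow_sub_C {K : Type*} [Field K] (p : ℕ) [Fact p.Prime] [CharP K p] (m : ℕ)
    (f : K[X]) : X ^ p ^ m ∣ f ^ p ^ m - C (f.eval 0 ^ p ^ m) := by
  rw [C_pow, ← sub_pow_char_pow]
  refine pow_dvd_pow_of_dvd ?_ _
  rw [X_dvd_iff, coeff_zero_eq_eval_zero]
  simp

/-- The auxiliary polynomial of the Stepanov method. -/
noncomputable def auxPoly {F : Type*} [CommRing F] {D J n p : ℕ} (Q : ℕ) (A B : F[X])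
    (c : (Fin D × Fin J) × (Fin n × Fin p) → F) : F[X] :=
  ∑ i, C (c i) * X ^ (i.1.1 : ℕ) * (X ^ (Q * Q)) ^ (i.1.2 : ℕ) * (A * A ^ Q) ^ (i.2.1 : ℕ) *
    (B + B ^ Q) ^ (i.2.2 : ℕ)

/-- The expansion of the auxiliary polynomial around a point of a given fibre. -/
noncomputable def auxExpansion {F : Type*} [CommRing F] {D J n p : ℕ} (A B : F[X]) (u v : F)
    (c : (Fin D × Fin J) × (Fin n × Fin p) → F) : F[X][X] :=
  ∑ i, C (C (c i)) * (translateHom F X ^ (i.1.1 : ℕ) * (C X ^ (i.1.2 : ℕ) * (C (C u) ^ (i.2.1 : ℕ) *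
    (translateHom F A ^ (i.2.1 : ℕ) * (C A ^ (n - 1 - i.2.1) *
    (C (C v) + translateHom F B - C B) ^ (i.2.2 : ℕ))))))

lemma natDegree_auxPoly_le {F : Type*} [CommRing F] {D J n p : ℕ} (Q : ℕ) (A B : F[X])
    (c : (Fin D × Fin J) × (Fin n × Fin p) → F) :
    (auxPoly Q A B c).natDegree ≤ D + Q * Q * J + n * ((Q + 1) * A.natDegree) +
      p * (Q * B.natDegree + B.natDegree) := by
  refine natDegree_sum_le_of_forall_le _ _ fun i _ => ?_
  have h1 := i.1.1.2
  have h2 := i.1.2.2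
  have h3 := i.2.1.2
  have h4 := i.2.2.2
  refine natDegree_mul_le_of_le (natDegree_mul_le_of_le (natDegree_mul_le_of_le ?_ ?_) ?_) ?_
  · refine (natDegree_C_mul_le _ _).trans ((natDegree_X_pow_le _).trans h1.le)
  · rw [← pow_mul]
    exact (natDegree_X_pow_le _).trans (Nat.mul_le_mul_left _ h2.le)
  · refine natDegree_pow_le.trans (Nat.mul_le_mul h3.le ?_)
    rw [← pow_succ']
    exact natDegree_pow_le
  · refine natDegree_pow_le.trans (Nat.mul_le_mul h4.le ?_)
    refine (natDegree_add_le _ _).trans (max_le (by omega) (natDegree_pow_le.trans (by omega)))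

lemma natDegree_coeff_auxExpansion_le {F : Type*} [CommRing F] {D J n p : ℕ} (A B : F[X]) (u v : F)
    (c : (Fin D × Fin J) × (Fin n × Fin p) → F) (s : ℕ) :
    ((auxExpansion A B u v c).coeff s).natDegree ≤
      D + J + n * A.natDegree + p * B.natDegree := by
  rw [auxExpansion, finsetSum_coeff]
  refine natDegree_sum_le_of_forall_le _ _ fun i _ => ?_
  have h1 := i.1.1.2
  have h2 := i.1.2.2
  have h3 := i.2.1.2
  have h4 := i.2.2.2
  have hC : ∀ w : F, ∀ s, ((C (C w) : F[X][X]).coeff s).natDegree ≤ 0 := fun w s =>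
    (natDegree_coeff_C_le _ s).trans (by simp)
  have hX : ∀ s, ((translateHom F X).coeff s).natDegree ≤ 1 := fun s =>
    (natDegree_coeff_translateHom_le _ s).trans natDegree_X_le
  have hX' : ∀ s, ((C X : F[X][X]).coeff s).natDegree ≤ 1 := fun s =>
    (natDegree_coeff_C_le _ s).trans natDegree_X_le
  have hB : ∀ s, ((C (C v) + translateHom F B - C B).coeff s).natDegree ≤ B.natDegree := by
    intro s
    rw [coeff_sub, coeff_add]
    refine (natDegree_sub_le _ _).trans (max_le ((natDegree_add_le _ _).trans (max_le ?_ ?_)) ?_)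
    · exact (hC v s).trans (Nat.zero_le _)
    · exact natDegree_coeff_translateHom_le _ s
    · exact natDegree_coeff_C_le _ s
  refine (natDegree_coeff_mul_le (hC _) (natDegree_coeff_mul_le (natDegree_coeff_pow_le hX _)
    (natDegree_coeff_mul_le (natDegree_coeff_pow_le hX' _)
    (natDegree_coeff_mul_le (natDegree_coeff_pow_le (hC u) _)
    (natDegree_coeff_mul_le (natDegree_coeff_pow_le (natDegree_coeff_translateHom_le A) _)
    (natDegree_coeff_mul_le (natDegree_coeff_pow_le (natDegree_coeff_C_le A) _)
      (natDegree_coeff_pow_le hB _)))))) s).trans ?_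
  have h5 : (i.2.1 : ℕ) * A.natDegree + (n - 1 - (i.2.1 : ℕ)) * A.natDegree ≤
      n * A.natDegree := by
    rw [← add_mul]
    exact Nat.mul_le_mul_right _ (by omega)
  have h6 : (i.2.2 : ℕ) * B.natDegree ≤ p * B.natDegree := Nat.mul_le_mul_right _ h4.le
  omega

/-- If there are more unknowns than conditions, some nonzero choice of coefficients makes the
expansion vanish to order `Q`. -/
lemma exists_X_pow_dvd_auxExpansion {F : Type*} [Field F] {D J n p : ℕ} (Q : ℕ) (A B : F[X])
    (u v : F)
    (h : Q * (D + J + n * A.natDegree + p * B.natDegree + 1) < D * J * (n * p)) :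
    ∃ c : (Fin D × Fin J) × (Fin n × Fin p) → F, c ≠ 0 ∧ X ^ Q ∣ auxExpansion A B u v c := by
  set W := D + J + n * A.natDegree + p * B.natDegree with hW
  let L : ((Fin D × Fin J) × (Fin n × Fin p) → F) →ₗ[F] (Fin Q × Fin (W + 1) → F) :=
    { toFun := fun c s => ((auxExpansion A B u v c).coeff s.1).coeff s.2
      map_add' := by
        intro c c'
        ext s
        simp [auxExpansion, add_mul, Finset.sum_add_distrib]
      map_smul' := by
        intro r c
        ext s
        simp only [auxExpansion, Pi.smul_apply, smul_eq_mul, C_mul, mul_assoc, ← Finset.mul_sum,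
          coeff_C_mul, RingHom.id_apply] }
  have hker : LinearMap.ker L ≠ ⊥ := by
    apply LinearMap.ker_ne_bot_of_finrank_lt
    simpa using h
  obtain ⟨c, hc, hc0⟩ := (Submodule.ne_bot_iff _).mp hker
  refine ⟨c, hc0, ?_⟩
  rw [X_pow_dvd_iff]
  intro s hs
  ext w
  rw [coeff_zero]
  by_cases hw : w < W + 1
  · exact congrFun (LinearMap.mem_ker.mp hc) (⟨s, hs⟩, ⟨w, hw⟩)
  · exact coeff_eq_zero_of_natDegree_lt
      ((natDegree_coeff_auxExpansion_le A B u v c s).trans_lt (by omega))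

/-- The auxiliary polynomial vanishes to order `Q` at the points of the fibre. -/
lemma X_sub_C_pow_dvd_auxPoly {F K : Type*} [Field F] [Field K] (φ : F →+* K) (p : ℕ)
    [Fact p.Prime] [CharP K p] (m : ℕ) {D J n r : ℕ} (A B : F[X]) (u v : F) (hu : u ≠ 0)
    (c : (Fin D × Fin J) × (Fin n × Fin r) → F)
    (hc : X ^ p ^ m ∣ auxExpansion A B u v c) (x : K) (hx : x ^ (p ^ m * p ^ m) = x)
    (hA : A.eval₂ φ x * (A.eval₂ φ x) ^ p ^ m = φ u)
    (hB : B.eval₂ φ x + (B.eval₂ φ x) ^ p ^ m = φ v) :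
    (X - C x) ^ p ^ m ∣ (auxPoly (p ^ m) A B c).map φ := by
  set Q := p ^ m with hQ
  set ε : F[X][X] →+* K[X] := mapRingHom (eval₂RingHom φ x) with hε
  set ρ : F[X] →+* K[X] := eval₂RingHom (C.comp φ) (X + C x) with hρ
  have hερ : ∀ f, ε (translateHom F f) = ρ f := by
    intro f
    have : ε.comp (translateHom F) = ρ := by
      refine ringHom_ext ?_ ?_ <;> simp [hε, hρ, translateHom]
    rw [← this]; rfl
  have hεC : ∀ f, ε (C f) = C (f.eval₂ φ x) := by
    intro f; simp [hε]
  have hρmap : ∀ f, ρ f = (f.map φ).comp (X + C x) := by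
    intro f
    simp [hρ, comp, eval₂_map]
  set I : Ideal K[X] := Ideal.span {X ^ Q} with hI
  set π := Ideal.Quotient.mk I with hπ
  have hpow : ∀ f : K[X], π f ^ Q = π (C (f.eval 0)) ^ Q := by
    intro f
    rw [← map_pow, ← map_pow, hπ, Ideal.Quotient.mk_eq_mk_iff_sub_mem, hI,
      Ideal.mem_span_singleton, ← C_pow]
    exact X_pow_dvd_pow_sub_C p m f
  have hρ0 : ∀ f, (ρ f).eval 0 = f.eval₂ φ x := by
    intro f
    rw [hρmap]
    simp [eval_comp, eval_map]
  set a := A.eval₂ φ x with ha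
  set b := B.eval₂ φ x with hb
  have ha0 : a ≠ 0 := by
    rintro h
    rw [h, zero_mul] at hA
    exact hu (φ.injective (by simp [← hA]))
  have hAρ : π (ρ (A ^ Q)) = π (C a) ^ Q := by
    rw [map_pow, map_pow, hpow, hρ0]
  have hBρ : π (ρ (B + B ^ Q)) = π (ρ B) + π (C b) ^ Q := by
    rw [map_add, map_add, map_pow, map_pow, hpow, hρ0]
  have hXρ : π (ρ (X ^ (Q * Q))) = π (C x) := by
    rw [pow_mul, map_pow, map_pow, hpow, hρ0, eval₂_pow, eval₂_X, ← map_pow, ← C_pow, ← pow_mul, hx]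
  have hA' : π (C (φ u)) = π (C a) * π (C a) ^ Q := by
    rw [← hA, C_mul, C_pow, map_mul, map_pow]
  have hB' : π (C (φ v)) = π (C b) + π (C b) ^ Q := by
    rw [← hB, C_add, C_pow, map_add, map_pow]
  have hεΞ : π (ε (auxExpansion A B u v c)) = 0 := by
    rw [hπ, Ideal.Quotient.eq_zero_iff_mem, hI, Ideal.mem_span_singleton]
    have := map_dvd ε hc
    simpa [hε] using this
  have hmain : π (C a) ^ (n - 1) * π (ρ (auxPoly Q A B c)) = 0 := by
    rw [← hεΞ, auxPoly, auxExpansion]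
    simp only [map_sum, Finset.mul_sum]
    refine Finset.sum_congr rfl fun i _ => ?_
    have hi := i.2.1.2
    have hs : π (C a) ^ (n - 1) = π (C a) ^ (n - 1 - (i.2.1 : ℕ)) * π (C a) ^ (i.2.1 : ℕ) := by
      rw [← pow_add]; congr 1; omega
    have hρX : ρ X = X + C x := by simp [hρ]
    have hρC : ∀ w, ρ (C w) = C (φ w) := by simp [hρ]
    simp only [map_mul ρ, map_mul π, map_mul ε, map_pow ρ _ (Fin.val _), map_pow π _ (Fin.val _),
      map_pow ε, map_add ε, map_sub ε, map_add π, map_sub π, hερ, hεC, eval₂_C, eval₂_X, hρC,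
      map_pow π _ (n - 1 - _), ← ha, ← hb, hA', hB']
    rw [hAρ, hBρ, hXρ, hs]
    ring
  have hunit : IsUnit (π (C a) ^ (n - 1)) :=
    (((isUnit_C.mpr (isUnit_iff_ne_zero.mpr ha0)).map π)).pow _
  have hzero := (hunit.mul_right_eq_zero).mp hmain
  rw [hπ, Ideal.Quotient.eq_zero_iff_mem, hI, Ideal.mem_span_singleton, hρmap] at hzero
  have h2 := map_dvd (compRingHom (X - C x)) hzero
  simpa [comp_assoc] using h2

lemma card_mul_le_natDegree {K : Type*} [Field K] (S : Finset K) (Q : ℕ) (P : K[X]) (hP : P ≠ 0)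
    (h : ∀ x ∈ S, (X - C x) ^ Q ∣ P) : S.card * Q ≤ P.natDegree := by
  have hdvd : ∏ x ∈ S, (X - C x) ^ Q ∣ P := by
    refine Finset.prod_dvd_of_coprime ?_ h
    intro x _ y _ hxy
    exact (isCoprime_X_sub_C_of_isUnit_sub (sub_ne_zero.mpr hxy).isUnit).pow
  have := natDegree_le_of_dvd hdvd hP
  rw [natDegree_prod_of_monic _ _ fun x _ => (monic_X_sub_C x).pow Q] at this
  simpa using this

lemma sum_pow_range_two_mul (p m : ℕ) :
    ∑ i ∈ Finset.range (2 * m), p ^ i =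
      ∑ i ∈ Finset.range m, p ^ i + (∑ i ∈ Finset.range m, p ^ i) * p ^ m := by
  rw [two_mul, Finset.sum_range_add, Finset.sum_mul]
  simp [pow_add, mul_comm]

lemma sum_pow_pow_range_two_mul {R : Type*} [CommRing R] (p m : ℕ) [Fact p.Prime] [CharP R p]
    (y : R) : ∑ i ∈ Finset.range (2 * m), y ^ p ^ i =
      ∑ i ∈ Finset.range m, y ^ p ^ i + (∑ i ∈ Finset.range m, y ^ p ^ i) ^ p ^ m := by
  rw [two_mul, Finset.sum_range_add, sum_pow_char_pow]
  simp_rw [← pow_mul, pow_add, mul_comm]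

lemma pred_mul_sum_pow (p m : ℕ) (hp : 0 < p) :
    (∑ i ∈ Finset.range m, p ^ i) * (p - 1) = p ^ m - 1 := by
  have h := geom_sum_mul_add (p - 1) m
  rw [show p - 1 + 1 = p by omega] at h
  omega

lemma sum_pow_pow_char {R : Type*} [CommRing R] (p m : ℕ) [Fact p.Prime] [CharP R p]
    (y : R) : (∑ i ∈ Finset.range m, y ^ p ^ i) ^ p =
      ∑ i ∈ Finset.range m, y ^ p ^ i + (y ^ p ^ m - y) := by
  rw [sum_pow_char]
  simp_rw [← pow_mul, ← pow_succ]
  have h1 := Finset.sum_range_succ (fun i => y ^ p ^ i) m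
  rw [Finset.sum_range_succ' (fun i => y ^ p ^ i) m] at h1
  simp only [pow_zero, pow_one] at h1
  linear_combination h1

lemma auxPoly_ne_zero (p : ℕ) [Fact p.Prime] (hp2 : 2 < p) (g₁ h : (ZMod p)[X]) (α : ZMod p)
    (hα : g₁.eval α ≠ 0) (hh : 0 < h.natDegree) (hhp : h.natDegree < p) :
    ∃ K, ∀ (m D J : ℕ) (A B : (ZMod p)[X]), (p - 1) * p * (D + K) < p ^ (2 * m) →
      (A * A ^ p ^ m) ^ (p - 1) = ((X - C α) * g₁) ^ (p ^ (2 * m) - 1) →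
      (B + B ^ p ^ m) ^ p = B + B ^ p ^ m + (h ^ p ^ (2 * m) - h) →
      ∀ c : (Fin D × Fin J) × (Fin (p - 1) × Fin p) → ZMod p, c ≠ 0 →
        auxPoly (p ^ m) A B c ≠ 0 := by
  obtain ⟨K, hK⟩ := sum_mul_pow_mul_pow_ne_zero p hp2 g₁ h α hα hh hhp
  refine ⟨K, fun m D J A B hm hA hB c hc => ?_⟩
  let c' : Fin (p - 1) × Fin p → (ZMod p)[X][X] := fun k =>
    ∑ i : Fin D × Fin J, monomial (i.1 : ℕ) (monomial (i.2 : ℕ) (c (i, k)))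
  have hdeg : ∀ k, (c' k).natDegree ≤ D := fun k =>
    natDegree_sum_le_of_forall_le _ _ fun i _ => (natDegree_monomial_le _).trans i.1.2.le
  have hcoeff : ∀ k (i : Fin D) (j : Fin J), ((c' k).coeff i).coeff j = c ((i, j), k) := by
    intro k i j
    simp only [c', finsetSum_coeff, coeff_monomial]
    rw [Finset.sum_eq_single (i, j)]
    · simp
    · rintro ⟨i', j'⟩ _ hne
      by_cases hi : i' = i
      · have hj : j' ≠ j := by rintro rfl; exact hne (by rw [hi])
        simp [hi, coeff_monomial, Fin.val_inj, hj]
      · simp [Fin.val_inj, hi]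
    · simp
  have hne : c' ≠ 0 := by
    intro h0
    refine hc (funext fun i => ?_)
    rw [show i = ((i.1.1, i.1.2), i.2) from rfl, ← hcoeff, h0]
    simp
  have := hK (2 * m) D hm _ _ hA hB c' hdeg hne
  convert this using 1
  rw [auxPoly, Fintype.sum_prod_type_right]
  refine Finset.sum_congr rfl fun k _ => ?_
  simp only [c', map_sum, Finset.sum_mul]
  refine Finset.sum_congr rfl fun i _ => ?_
  rw [← C_mul_X_pow_eq_monomial, ← C_mul_X_pow_eq_monomial, map_mul, map_pow, C_mul, C_pow,
    map_mul, map_pow, powSpecialization_C, powSpecialization_C]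
  simp only [expand_C, expand_X, powSpecialization, coe_eval₂RingHom, eval₂_X]
  rw [two_mul, pow_add]
  ring

/-- The Stepanov upper bound for the number of points in a joint fibre of norm and trace. -/
theorem stepanov_bound (p : ℕ) [Fact p.Prime] (hp2 : 2 < p) (g₁ h : (ZMod p)[X]) (α : ZMod p)
    (hα : g₁.eval α ≠ 0) (hh : 0 < h.natDegree) (hhp : h.natDegree < p) :
    ∃ c m₀ : ℕ, ∀ m ≥ m₀, ∀ (K : Type) [Field K] [Algebra (ZMod p) K] (u v : ZMod p), u ≠ 0 →
      ∀ S : Finset K, (∀ x ∈ S, x ^ p ^ (2 * m) = x ∧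
        (aeval x ((X - C α) * g₁)) ^ (∑ i ∈ Finset.range (2 * m), p ^ i) = algebraMap (ZMod p) K u ∧
        ∑ i ∈ Finset.range (2 * m), (aeval x h) ^ p ^ i = algebraMap (ZMod p) K v) →
      (p - 1) * p * S.card ≤ p ^ (2 * m) + c * p ^ m := by
  obtain ⟨K₀, hK₀⟩ := auxPoly_ne_zero p hp2 g₁ h α hα hh hhp
  set g := (X - C α) * g₁ with hg
  set n := p - 1 with hn
  set e := n * p with he
  set s := 2 * e with hs
  set c3 := n * g.natDegree + p * h.natDegree with hc3
  set c1 := 1 + p ^ s * (c3 + 4) with hc1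
  have hp1 : 1 < p := by omega
  have he1 : 1 ≤ e := Nat.mul_pos (by omega) (by omega)
  refine ⟨1 + c1 * e + 2 * e * c3, s + c1 + 2 * e * K₀ + 1, ?_⟩
  intro m hm K _ _ u v hu S hS
  set Q := p ^ m with hQ
  have hmQ : m < Q := Nat.lt_pow_self hp1
  have hq : p ^ (2 * m) = Q * Q := by rw [two_mul, pow_add]
  set D := p ^ (2 * m - s) with hD
  have hDP : D * p ^ s = Q * Q := by
    rw [hD, ← hq, ← pow_add]; congr 1; omega
  set J := Q / e + c1 with hJ
  set σ := ∑ i ∈ Finset.range m, p ^ i with hσ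
  have hσQ : σ ≤ Q := by
    have h1 : σ * n = Q - 1 := pred_mul_sum_pow p m (by omega)
    have h2 : σ * 1 ≤ σ * n := Nat.mul_le_mul_left _ (by omega)
    omega
  set A := g ^ σ with hA
  set B := ∑ i ∈ Finset.range m, h ^ p ^ i with hB
  have hAdeg : A.natDegree ≤ Q * g.natDegree :=
    natDegree_pow_le.trans (Nat.mul_le_mul_right _ hσQ)
  have hBdeg : B.natDegree ≤ Q * h.natDegree := by
    refine natDegree_sum_le_of_forall_le _ _ fun i hi => natDegree_pow_le.trans
      (Nat.mul_le_mul_right _ (Nat.pow_le_pow_right (by omega) (Finset.mem_range.mp hi).le))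
  have hAA : A * A ^ Q = g ^ (∑ i ∈ Finset.range (2 * m), p ^ i) := by
    rw [sum_pow_range_two_mul, pow_add, pow_mul]
  have hBB : B + B ^ Q = ∑ i ∈ Finset.range (2 * m), h ^ p ^ i :=
    (sum_pow_pow_range_two_mul p m h).symm
  have hab : n * A.natDegree + p * B.natDegree ≤ Q * c3 := by
    calc _ ≤ n * (Q * g.natDegree) + p * (Q * h.natDegree) := by gcongr
      _ = _ := by rw [hc3]; ring
  have hJe : J * e ≤ Q + c1 * e := by
    rw [hJ, add_mul]; gcongr; exact Nat.div_mul_le_self _ _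
  have hJe' : Q + (c1 - 1) * e ≤ J * e := by
    have h1 : Q < e * (Q / e + 1) := Nat.lt_mul_div_succ Q he1
    have : J * e = e * (Q / e + 1) + (c1 - 1) * e := by
      rw [hJ, hc1]
      simp only [Nat.add_sub_cancel_left]; ring
    omega
  have hJle : J ≤ Q + c1 := by
    rw [hJ]; gcongr; exact Nat.div_le_self _ _
  have hcount : Q * (D + J + n * A.natDegree + p * B.natDegree + 1) < D * J * (n * p) := by
    have h1 : Q * (D + J + n * A.natDegree + p * B.natDegree + 1) ≤
        Q * D + Q * Q * (c3 + 3) := by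
      have h2 : D + J + n * A.natDegree + p * B.natDegree + 1 ≤ D + Q * (c3 + 3) := by
        rw [mul_add]; omega
      calc _ ≤ Q * (D + Q * (c3 + 3)) := Nat.mul_le_mul_left _ h2
        _ = _ := by ring
    have h3 : Q * D + Q * Q * (c3 + 4) ≤ D * J * (n * p) := by
      calc Q * D + Q * Q * (c3 + 4) = D * (Q + p ^ s * (c3 + 4) * 1) := by
            rw [← hDP]; ring
        _ ≤ D * (Q + (c1 - 1) * e) := by
            rw [hc1, Nat.add_sub_cancel_left]; gcongr
        _ ≤ D * (J * e) := Nat.mul_le_mul_left _ hJe'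
        _ = _ := by rw [he]; ring
    have hQQ : 0 < Q * Q := by positivity
    nlinarith
  have hDe : 2 * (e * D) ≤ Q * Q := by
    rw [← hDP]
    calc 2 * (e * D) = D * s := by rw [hs]; ring
      _ ≤ D * p ^ s := Nat.mul_le_mul_left _ (Nat.lt_pow_self hp1).le
  have hQle : Q ≤ Q * Q := Nat.le_mul_self Q
  have hKD : (p - 1) * p * (D + K₀) < p ^ (2 * m) := by
    rw [hq, ← hn, ← he, mul_add]
    have h1 : 2 * e * K₀ < Q := by linarith
    linarith
  obtain ⟨c, hc, hdvd⟩ := exists_X_pow_dvd_auxExpansion Q A B u v hcount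
  have hne : auxPoly Q A B c ≠ 0 := by
    refine hK₀ m D J A B hKD ?_ ?_ c hc
    · rw [hAA, ← pow_mul, pred_mul_sum_pow p _ (by omega)]
    · rw [hBB, sum_pow_pow_char]
  have : CharP K p := charP_of_injective_algebraMap (algebraMap (ZMod p) K).injective p
  have hcard := card_mul_le_natDegree S Q ((auxPoly Q A B c).map (algebraMap (ZMod p) K))
    ((Polynomial.map_ne_zero_iff (algebraMap (ZMod p) K).injective).mpr hne) (by
      intro x hx
      obtain ⟨hx1, hx2, hx3⟩ := hS x hx
      refine X_sub_C_pow_dvd_auxPoly (algebraMap (ZMod p) K) p m A B u v hu c hdvd x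
        (by rw [← hQ, ← hq]; exact hx1) ?_ ?_
      · rw [← hx2, ← aeval_def, ← map_pow, ← map_mul, hAA, map_pow]
      · rw [← hx3, ← aeval_def, ← map_pow, ← map_add, hBB, map_sum]
        simp)
  rw [natDegree_map] at hcard
  have hdeg := natDegree_auxPoly_le Q A B c
  have hQpos : 0 < Q := by positivity
  have h4 : n * ((Q + 1) * A.natDegree) + p * (Q * B.natDegree + B.natDegree) ≤
      2 * (Q * Q * c3) := by
    calc _ = (Q + 1) * (n * A.natDegree + p * B.natDegree) := by ring
      _ ≤ (2 * Q) * (Q * c3) := Nat.mul_le_mul (by omega) hab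
      _ = _ := by ring
  have h5 : S.card * Q ≤ D + Q * Q * J + 2 * (Q * Q * c3) := by omega
  refine Nat.le_of_mul_le_mul_right ?_ hQpos
  calc e * S.card * Q = e * (S.card * Q) := by ring
    _ ≤ e * (D + Q * Q * J + 2 * (Q * Q * c3)) := Nat.mul_le_mul_left _ h5
    _ = e * D + Q * Q * (J * e) + 2 * e * c3 * (Q * Q) := by ring
    _ ≤ Q * Q + Q * Q * (Q + c1 * e) + 2 * e * c3 * (Q * Q) := by
        have h6 : e * D ≤ Q * Q := by linarith
        exact Nat.add_le_add (Nat.add_le_add h6 (Nat.mul_le_mul_left _ hJe)) le_rfl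
    _ = _ := by rw [hq]; ring

/-- An upper bound for all fibres gives a two-sided bound for a balanced weighted sum. -/
lemma norm_sum_comp_le {ι X : Type*} [DecidableEq ι] (S : Finset X) (I : Finset ι) (φ : X → ι)
    (hφ : ∀ x ∈ S, φ x ∈ I) (w : ι → ℂ) (hw : ∀ i ∈ I, ‖w i‖ ≤ 1) (hw0 : ∑ i ∈ I, w i = 0)
    (e M : ℝ) (he : 0 ≤ e) (hN : ∀ i ∈ I, e * (S.filter (φ · = i)).card ≤ M) :
    e * ‖∑ x ∈ S, w (φ x)‖ ≤ I.card * M - e * S.card := by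
  have h1 : ∑ x ∈ S, w (φ x) = ∑ i ∈ I, ((S.filter (φ · = i)).card : ℂ) * w i := by
    rw [← Finset.sum_fiberwise_of_maps_to hφ]
    refine Finset.sum_congr rfl fun i _ => ?_
    rw [Finset.sum_congr rfl fun x hx => by rw [(Finset.mem_filter.mp hx).2], Finset.sum_const,
      nsmul_eq_mul]
  have h2 : (e : ℂ) * ∑ x ∈ S, w (φ x) =
      -∑ i ∈ I, ((M - e * (S.filter (φ · = i)).card : ℝ) : ℂ) * w i := by
    rw [h1, Finset.mul_sum, ← Finset.sum_neg_distrib, ← sub_eq_zero, ← Finset.sum_sub_distrib,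
      ← mul_zero (M : ℂ), ← hw0, Finset.mul_sum]
    refine Finset.sum_congr rfl fun i _ => ?_
    push_cast
    ring
  have h3 : (S.card : ℝ) = ∑ i ∈ I, ((S.filter (φ · = i)).card : ℝ) := by
    rw [Finset.card_eq_sum_card_fiberwise hφ]
    push_cast
    rfl
  calc e * ‖∑ x ∈ S, w (φ x)‖ = ‖(e : ℂ) * ∑ x ∈ S, w (φ x)‖ := by
        rw [norm_mul, Complex.norm_real, Real.norm_of_nonneg he]
    _ ≤ ∑ i ∈ I, (M - e * (S.filter (φ · = i)).card) := by
        rw [h2, norm_neg]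
        refine norm_sum_le_of_le _ fun i hi => ?_
        rw [norm_mul, Complex.norm_real, Real.norm_of_nonneg (sub_nonneg.mpr (hN i hi))]
        exact mul_le_of_le_one_right (sub_nonneg.mpr (hN i hi)) (hw i hi)
    _ = I.card * M - e * S.card := by
        rw [Finset.sum_sub_distrib, ← Finset.mul_sum, ← h3, Finset.sum_const, nsmul_eq_mul]

/-- The mixed character sum over a finite extension of `ZMod p`. -/
noncomputable def mixedSum {p : ℕ} [Fact p.Prime] (χ : MulChar (ZMod p) ℂ)
    (ψ : AddChar (ZMod p) ℂ) (g h : (ZMod p)[X]) (K : Type) [Field K] [Fintype K]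
    [Algebra (ZMod p) K] : ℂ :=
  ∑ x : K, χ (Algebra.norm (ZMod p) (aeval x g)) * ψ (Algebra.trace (ZMod p) K (aeval x h))

/-- The square-root bound, with an unspecified constant, over extensions of large even degree. -/
theorem norm_mixedSum_le_of_stepanov (p : ℕ) [Fact p.Prime] (hp2 : 2 < p) (g₁ h : (ZMod p)[X])
    (α : ZMod p) (hα : g₁.eval α ≠ 0) (hh : 0 < h.natDegree) (hhp : h.natDegree < p)
    (χ : MulChar (ZMod p) ℂ) (hχ : χ ≠ 1) (ψ : AddChar (ZMod p) ℂ) :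
    ∃ c m₀ : ℕ, ∀ m ≥ m₀, ∀ (K : Type) [Field K] [Fintype K] [Algebra (ZMod p) K],
      Fintype.card K = p ^ (2 * m) →
        ‖mixedSum χ ψ ((X - C α) * g₁) h K‖ ≤ c * (p : ℝ) ^ m := by
  classical
  obtain ⟨c, m₀, hc⟩ := stepanov_bound p hp2 g₁ h α hα hh hhp
  set g := (X - C α) * g₁ with hg
  have hg0 : g ≠ 0 := mul_ne_zero (X_sub_C_ne_zero α) (by rintro rfl; simp at hα)
  refine ⟨c + g.natDegree, m₀, fun m hm K _ _ _ hK => ?_⟩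
  have hfin : Module.finrank (ZMod p) K = 2 * m := by
    have := Module.card_eq_pow_finrank (K := ZMod p) (V := K)
    rw [hK, ZMod.card] at this
    exact (Nat.pow_right_injective (Fact.out : p.Prime).two_le this).symm
  have hnorm : ∀ y : K, algebraMap (ZMod p) K (Algebra.norm (ZMod p) y) =
      y ^ ∑ i ∈ Finset.range (2 * m), p ^ i := fun y => by
    rw [FiniteField.algebraMap_norm_eq_pow_sum, hfin, Nat.card_zmod]
  have htrace : ∀ y : K, algebraMap (ZMod p) K (Algebra.trace (ZMod p) K y) =
      ∑ i ∈ Finset.range (2 * m), y ^ p ^ i := fun y => by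
    rw [FiniteField.algebraMap_trace_eq_sum_pow, hfin, Nat.card_zmod]
  set S : Finset K := Finset.univ.filter fun x => aeval x g ≠ 0 with hS
  set I : Finset (ZMod p × ZMod p) := (Finset.univ.filter (· ≠ 0)) ×ˢ Finset.univ with hI
  set w : ZMod p × ZMod p → ℂ := fun i => χ i.1 * ψ i.2 with hw
  set φ : K → ZMod p × ZMod p := fun x =>
    (Algebra.norm (ZMod p) (aeval x g), Algebra.trace (ZMod p) K (aeval x h)) with hφ
  have hsum : mixedSum χ ψ g h K = ∑ x ∈ S, w (φ x) := by
    rw [mixedSum, hS, Finset.sum_filter]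
    refine Finset.sum_congr rfl fun x _ => ?_
    split_ifs with hx
    · rfl
    · rw [not_not.mp hx, Algebra.norm_zero, MulChar.map_zero, zero_mul]
  have hw0 : ∑ i ∈ I, w i = 0 := by
    have : ∑ u ∈ Finset.univ.filter (fun u : ZMod p => u ≠ 0), χ u = 0 := by
      rw [← MulChar.sum_eq_zero_of_ne_one hχ, Finset.sum_filter]
      refine Finset.sum_congr rfl fun u _ => ?_
      split_ifs with hu
      · rfl
      · rw [not_not.mp hu, MulChar.map_zero]
    rw [hI, Finset.sum_product, hw]
    simp_rw [← Finset.mul_sum, ← Finset.sum_mul]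
    rw [this, zero_mul]
  have hw1 : ∀ i ∈ I, ‖w i‖ ≤ 1 := by
    intro i _
    rw [hw, norm_mul, ψ.norm_apply, mul_one]
    exact DirichletCharacter.norm_le_one χ _
  have hIcard : I.card = (p - 1) * p := by
    rw [hI, Finset.card_product, Finset.filter_ne', Finset.card_erase_of_mem (Finset.mem_univ _),
      Finset.card_univ, ZMod.card]
  have hScard : p ^ (2 * m) ≤ S.card + g.natDegree := by
    rw [← hK, ← Finset.card_univ,
      ← Finset.card_filter_add_card_filter_not (s := Finset.univ) (fun x : K => aeval x g ≠ 0)]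
    refine Nat.add_le_add_left ?_ _
    have hm0 : g.map (algebraMap (ZMod p) K) ≠ 0 :=
      (Polynomial.map_ne_zero_iff (algebraMap (ZMod p) K).injective).mpr hg0
    calc _ ≤ (g.map (algebraMap (ZMod p) K)).roots.toFinset.card := by
          refine Finset.card_le_card fun x hx => ?_
          rw [Multiset.mem_toFinset, mem_roots hm0, IsRoot, eval_map_algebraMap]
          simpa using hx
      _ ≤ _ := (Multiset.toFinset_card_le _).trans
          ((card_roots' _).trans natDegree_map_le)
  have key := norm_sum_comp_le S I φ (by
      intro x hx
      rw [hI, Finset.mem_product]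
      refine ⟨?_, Finset.mem_univ _⟩
      rw [Finset.mem_filter]
      refine ⟨Finset.mem_univ _, ?_⟩
      rw [Ne, Algebra.norm_eq_zero_iff]
      exact (Finset.mem_filter.mp hx).2) w hw1 hw0
    (((p - 1) * p : ℕ) : ℝ) ((p ^ (2 * m) + c * p ^ m : ℕ) : ℝ) (by positivity) (by
      intro i hi
      have := hc m hm K i.1 i.2 (by simpa [hI] using hi) (S.filter (φ · = i)) (by
        intro x hx
        have hx2 := (Finset.mem_filter.mp hx).2
        refine ⟨by rw [← hK, FiniteField.pow_card], ?_, ?_⟩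
        · rw [← hnorm, ← hx2]
        · rw [← htrace, ← hx2])
      exact_mod_cast this)
  rw [hsum]
  have he : (0 : ℝ) < (((p - 1) * p : ℕ) : ℝ) := by
    exact_mod_cast Nat.mul_pos (by omega) (by omega)
  refine le_of_mul_le_mul_left (key.trans ?_) he
  rw [hIcard, ← mul_sub]
  refine mul_le_mul_of_nonneg_left ?_ he.le
  have h1 : ((p : ℝ) ^ (2 * m)) ≤ S.card + g.natDegree := by exact_mod_cast hScard
  have h2 : (1 : ℝ) ≤ (p : ℝ) ^ m := one_le_pow₀ (by exact_mod_cast (by omega : 1 ≤ p))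
  push_cast
  nlinarith [(Nat.cast_nonneg g.natDegree : (0 : ℝ) ≤ g.natDegree)]

section LogDeriv

variable {F : Type*} [Field F]

/-- The negated logarithmic derivative of the reversed polynomial; its coefficients are the power
sums of the roots. -/
noncomputable def logDerivSeries (P : F[X]) : PowerSeries F :=
  -((derivative P.reverse : F[X]) : PowerSeries F) * ((P.reverse : F[X]) : PowerSeries F)⁻¹

lemma constantCoeff_reverse_ne_zero {P : F[X]} (hP : P ≠ 0) :
    PowerSeries.constantCoeff ((P.reverse : F[X]) : PowerSeries F) ≠ 0 := by
  rw [constantCoeff_coe, coeff_zero_reverse]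
  exact leadingCoeff_ne_zero.mpr hP

lemma logDerivSeries_eq_iff {P : F[X]} (hP : P ≠ 0) {s : PowerSeries F} :
    logDerivSeries P = s ↔ s * ((P.reverse : F[X]) : PowerSeries F) =
      -((derivative P.reverse : F[X]) : PowerSeries F) := by
  rw [logDerivSeries, eq_comm, PowerSeries.eq_mul_inv_iff_mul_eq (constantCoeff_reverse_ne_zero hP)]

lemma logDerivSeries_mul {P Q : F[X]} (hP : P ≠ 0) (hQ : Q ≠ 0) :
    logDerivSeries (P * Q) = logDerivSeries P + logDerivSeries Q := by
  have h1 := (logDerivSeries_eq_iff hP).mp rfl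
  have h2 := (logDerivSeries_eq_iff hQ).mp rfl
  rw [logDerivSeries_eq_iff (mul_ne_zero hP hQ), reverse_mul_of_domain, derivative_mul]
  push_cast
  linear_combination (Q.reverse : PowerSeries F) * h1 + (P.reverse : PowerSeries F) * h2

lemma logDerivSeries_one : logDerivSeries (1 : F[X]) = 0 := by
  rw [logDerivSeries_eq_iff one_ne_zero, ← C_1, reverse_C]
  simp

lemma logDerivSeries_X_sub_C (a : F) :
    logDerivSeries (X - C a) = PowerSeries.mk fun k => a ^ (k + 1) := by
  have hrev : (X - C a).reverse = 1 - C a * X := by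
    ext n
    rw [coeff_reverse, natDegree_X_sub_C]
    rcases n with _ | _ | n
    · rw [revAt_le (by omega)]
      simp [coeff_C]
    · rw [revAt_le (by omega)]
      simp [coeff_one]
    · rw [revAt_eq_self_of_lt (by omega)]
      simp [coeff_X, coeff_one]
  rw [logDerivSeries_eq_iff (X_sub_C_ne_zero a), hrev]
  ext n
  simp only [derivative_one, derivative_C_mul, derivative_X, mul_one, zero_sub,
    coe_neg, coe_sub, coe_one, coe_mul, coe_C, coe_X, neg_neg, mul_sub, map_sub, PowerSeries.coeff_C,
    ← mul_assoc]
  rcases n with _ | n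
  · simp
  · rw [PowerSeries.coeff_succ_mul_X, mul_comm _ (PowerSeries.C a), PowerSeries.coeff_C_mul]
    simp [pow_succ']

lemma coeff_logDerivSeries_of_splits {P : F[X]} (hP : P.Monic) (hs : P.Splits) (k : ℕ) :
    PowerSeries.coeff k (logDerivSeries P) = (P.roots.map (· ^ (k + 1))).sum := by
  have key : ∀ s : Multiset F, PowerSeries.coeff k (logDerivSeries (s.map (X - C ·)).prod) =
      (s.map (· ^ (k + 1))).sum := by
    intro s
    induction s using Multiset.induction with
    | empty => simp [logDerivSeries_one]
    | cons a s ih =>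
      rw [Multiset.map_cons, Multiset.prod_cons, logDerivSeries_mul (X_sub_C_ne_zero a)
        (monic_multisetProd_X_sub_C s).ne_zero, map_add, ih, logDerivSeries_X_sub_C]
      simp
  rw [← key, ← hs.eq_prod_roots_of_monic hP]

lemma map_logDerivSeries {E : Type*} [Field E] (f : F →+* E) {P : F[X]} (hP : P ≠ 0) :
    PowerSeries.map f (logDerivSeries P) = logDerivSeries (P.map f) := by
  symm
  have hmap : ∀ Q : F[X], ((Q.map f : E[X]) : PowerSeries E) = PowerSeries.map f Q := by
    intro Q
    ext n
    simp
  have hrev : (P.map f).reverse = P.reverse.map f := by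
    rw [reverse, reverse, natDegree_map, reflect_map]
  rw [logDerivSeries_eq_iff ((Polynomial.map_ne_zero_iff f.injective).mpr hP), hrev,
    derivative_map, hmap, hmap, ← map_mul, ← map_neg, (logDerivSeries_eq_iff hP).mp rfl]

lemma coeff_logDerivSeries_congr {P Q : F[X]} (hP : P ≠ 0) (hQ : Q ≠ 0) (d : ℕ)
    (h : X ^ (d + 1) ∣ P.reverse - Q.reverse) {k : ℕ} (hk : k < d) :
    PowerSeries.coeff k (logDerivSeries P) = PowerSeries.coeff k (logDerivSeries Q) := by
  have h1 := (logDerivSeries_eq_iff hP).mp rfl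
  have h2 := (logDerivSeries_eq_iff hQ).mp rfl
  obtain ⟨R, hR⟩ := h
  have hR' : ((P.reverse : F[X]) : PowerSeries F) - ((Q.reverse : F[X]) : PowerSeries F) =
      (PowerSeries.X : PowerSeries F) ^ d * (PowerSeries.X * (R : PowerSeries F)) := by
    rw [← coe_sub, hR]
    push_cast
    ring
  have hD : ((derivative P.reverse : F[X]) : PowerSeries F) - ((derivative Q.reverse : F[X]) : PowerSeries F) =
      (PowerSeries.X : PowerSeries F) ^ d *
        ((C ((d : F) + 1) * R + X * derivative R : F[X]) : PowerSeries F) := by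
    rw [← coe_sub, ← derivative_sub, hR, derivative_mul, derivative_X_pow]
    push_cast
    simp
    ring
  have hdvd : (PowerSeries.X : PowerSeries F) ^ d ∣
      (logDerivSeries P - logDerivSeries Q) * ((P.reverse : F[X]) : PowerSeries F) := by
    have : (logDerivSeries P - logDerivSeries Q) * ((P.reverse : F[X]) : PowerSeries F) =
        -(((derivative P.reverse : F[X]) : PowerSeries F) - ((derivative Q.reverse : F[X]) : PowerSeries F)) -
          logDerivSeries Q * (((P.reverse : F[X]) : PowerSeries F) - ((Q.reverse : F[X]) : PowerSeries F)) := by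
      linear_combination h1 - h2
    rw [this, hR', hD]
    refine dvd_sub (dvd_neg.mpr (dvd_mul_right _ _)) (Dvd.dvd.mul_left (dvd_mul_right _ _) _)
  have hu : IsUnit ((P.reverse : F[X]) : PowerSeries F) :=
    PowerSeries.isUnit_iff_constantCoeff.mpr (constantCoeff_reverse_ne_zero hP).isUnit
  rw [hu.dvd_mul_right, PowerSeries.X_pow_dvd_iff] at hdvd
  have := hdvd k hk
  rwa [map_sub, sub_eq_zero] at this

end LogDeriv

open IntermediateField in
/-- Multiplying over all embeddings amounts to multiplying over the conjugates with multiplicity. -/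
lemma prod_embeddings_eq_prod_aroots (K L E : Type*) [Field K] [Field L] [Field E] [Algebra K L]
    [Algebra K E] [IsAlgClosed E] [FiniteDimensional K L] [Algebra.IsSeparable K L] {A : Type*}
    [CommMonoid A] (φ : E → A) (x : L) :
    ∏ σ : L →ₐ[K] E, φ (σ x) =
      (((minpoly K x).aroots E).map φ).prod ^ Module.finrank K⟮x⟯ L := by
  classical
  have hx := Algebra.IsSeparable.isIntegral K x
  rw [Fintype.prod_equiv algHomEquivSigma (fun σ : L →ₐ[K] E => _)
    (fun σ => φ (σ.1 (AdjoinSimple.gen K x))),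
    ← Finset.univ_sigma_univ, Finset.prod_sigma]
  · have h1 : ∀ σ : K⟮x⟯ →ₐ[K] E, (∏ _τ : (letI := σ.toRingHom.toAlgebra; L →ₐ[K⟮x⟯] E),
        φ (σ (AdjoinSimple.gen K x))) =
        φ (σ (AdjoinSimple.gen K x)) ^ Module.finrank K⟮x⟯ L := by
      intro σ
      let : Algebra K⟮x⟯ E := σ.toRingHom.toAlgebra
      simp_rw [Finset.prod_const, Finset.card_univ, ← AlgHom.card K⟮x⟯ L E]
    have hnd : ((minpoly K x).aroots E).Nodup :=
      nodup_roots ((separable_map _).mpr (Algebra.IsSeparable.isSeparable K x))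
    rw [Finset.prod_congr rfl fun σ _ => h1 σ, Finset.prod_pow]
    congr 1
    rw [show ((minpoly K x).aroots E) = ((minpoly K x).aroots E).toFinset.val by
      rw [Multiset.toFinset_val, hnd.dedup], ← Finset.prod_eq_multiset_prod]
    refine Finset.prod_bij' (fun σ _ => σ (AdjoinSimple.gen K x))
      (fun y hy => (algHomAdjoinIntegralEquiv K hx).symm ⟨y, Multiset.mem_toFinset.mp hy⟩)
      ?_ ?_ ?_ ?_ ?_
    · intro σ _
      rw [Multiset.mem_toFinset, mem_aroots]
      refine ⟨minpoly.ne_zero hx, ?_⟩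
      rw [aeval_algHom_apply, ← minpoly_gen K x, minpoly.aeval, map_zero]
    · intros; exact Finset.mem_univ _
    · intro σ _
      rw [Equiv.symm_apply_eq]
      ext
      rfl
    · intro y hy
      exact algHomAdjoinIntegralEquiv_symm_apply_gen K hx _
    · intros; rfl
  · intro σ
    rfl

open IntermediateField in
/-- Summing over all embeddings amounts to summing over the conjugates with multiplicity. -/
lemma sum_embeddings_eq_sum_aroots (K L E : Type*) [Field K] [Field L] [Field E] [Algebra K L]
    [Algebra K E] [IsAlgClosed E] [FiniteDimensional K L] [Algebra.IsSeparable K L] {A : Type*}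
    [AddCommMonoid A] (φ : E → A) (x : L) :
    ∑ σ : L →ₐ[K] E, φ (σ x) =
      Module.finrank K⟮x⟯ L • (((minpoly K x).aroots E).map φ).sum := by
  apply Multiplicative.ofAdd.injective
  have hs : ∀ s : Multiset E, Multiplicative.ofAdd (s.map φ).sum =
      (s.map fun y => Multiplicative.ofAdd (φ y)).prod := fun s => by
    induction s using Multiset.induction with
    | empty => simp
    | cons a s ih => simp [ih]
  rw [ofAdd_sum, ofAdd_nsmul, hs]
  exact prod_embeddings_eq_prod_aroots K L E (fun y => Multiplicative.ofAdd (φ y)) x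

/-- The sum of `h` over the roots of `P`, expressed through the coefficients of `P`. -/
noncomputable def rootSum {F : Type*} [Field F] (h P : F[X]) : F :=
  h.coeff 0 * P.natDegree +
    ∑ k ∈ Finset.range h.natDegree, h.coeff (k + 1) * PowerSeries.coeff k (logDerivSeries P)

lemma rootSum_mul {F : Type*} [Field F] (h : F[X]) {P Q : F[X]} (hP : P ≠ 0) (hQ : Q ≠ 0) :
    rootSum h (P * Q) = rootSum h P + rootSum h Q := by
  simp only [rootSum, natDegree_mul hP hQ, logDerivSeries_mul hP hQ, map_add, mul_add,
    Finset.sum_add_distrib, Nat.cast_add]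
  ring

lemma rootSum_one {F : Type*} [Field F] (h : F[X]) : rootSum h 1 = 0 := by
  simp [rootSum, logDerivSeries_one]

lemma sum_map_eval_eq {F : Type*} [Field F] (h : F[X]) (s : Multiset F) :
    (s.map fun y => h.eval y).sum = h.coeff 0 * s.card +
      ∑ k ∈ Finset.range h.natDegree, h.coeff (k + 1) * (s.map (· ^ (k + 1))).sum := by
  induction s using Multiset.induction with
  | empty => simp
  | cons a s ih =>
    simp only [Multiset.map_cons, Multiset.sum_cons, ih, mul_add, Finset.sum_add_distrib]
    rw [eval_eq_sum_range, Finset.sum_range_succ', Multiset.card_cons]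
    push_cast
    ring

lemma algebraMap_rootSum {F E : Type*} [Field F] [Field E] [Algebra F E] [IsAlgClosed E]
    (h : F[X]) {P : F[X]} (hP : P.Monic) :
    algebraMap F E (rootSum h P) = ((P.aroots E).map fun y => aeval y h).sum := by
  have h1 : ∀ k, algebraMap F E (PowerSeries.coeff k (logDerivSeries P)) =
      ((P.aroots E).map (· ^ (k + 1))).sum := by
    intro k
    rw [← PowerSeries.coeff_map, map_logDerivSeries _ hP.ne_zero,
      coeff_logDerivSeries_of_splits (hP.map _) (IsAlgClosed.splits _)]
  have h2 : ((P.aroots E).map fun y => aeval y h).sum =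
      ((P.aroots E).map fun y => (h.map (algebraMap F E)).eval y).sum := by
    simp only [eval_map_algebraMap]
  rw [h2, sum_map_eval_eq, rootSum, map_add, map_mul, map_sum, natDegree_map, coeff_map,
    aroots, IsAlgClosed.card_roots_eq_natDegree, natDegree_map, map_natCast]
  simp only [map_mul, h1, coeff_map]

lemma prod_map_prod_sub_eq {F ι : Type*} [Field F] (s : Finset ι) (a : ι → F) (t : Multiset F) :
    (t.map fun y => ∏ i ∈ s, (y - a i)).prod =
      ∏ i ∈ s, ((-1) ^ t.card * ((t.map (X - C ·)).prod).eval (a i)) := by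
  induction t using Multiset.induction with
  | empty => simp
  | cons b t ih =>
    simp only [Multiset.map_cons, Multiset.prod_cons, ih, ← Finset.prod_mul_distrib]
    refine Finset.prod_congr rfl fun i _ => ?_
    simp only [Multiset.card_cons, eval_mul, eval_sub, eval_X, eval_C]
    ring

section CharWeight

variable {p : ℕ} [Fact p.Prime]

/-- The completely multiplicative function on monic polynomials attached to a mixed character
sum. -/
noncomputable def charWeight (χ : MulChar (ZMod p) ℂ) (ψ : AddChar (ZMod p) ℂ)
    (s : Finset (ZMod p)) (h P : (ZMod p)[X]) : ℂ :=
  χ (∏ a ∈ s, ((-1) ^ P.natDegree * P.eval a)) * ψ (rootSum h P)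

lemma charWeight_mul (χ : MulChar (ZMod p) ℂ) (ψ : AddChar (ZMod p) ℂ)
    (s : Finset (ZMod p)) (h : (ZMod p)[X]) {P Q : (ZMod p)[X]} (hP : P ≠ 0) (hQ : Q ≠ 0) :
    charWeight χ ψ s h (P * Q) = charWeight χ ψ s h P * charWeight χ ψ s h Q := by
  have : ∏ a ∈ s, ((-1) ^ (P * Q).natDegree * (P * Q).eval a) =
      (∏ a ∈ s, ((-1) ^ P.natDegree * P.eval a)) * ∏ a ∈ s, ((-1) ^ Q.natDegree * Q.eval a) := by
    rw [← Finset.prod_mul_distrib, natDegree_mul hP hQ]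
    refine Finset.prod_congr rfl fun a _ => ?_
    rw [eval_mul]
    ring
  rw [charWeight, this, map_mul, rootSum_mul h hP hQ, AddChar.map_add_eq_mul, charWeight, charWeight]
  ring

lemma charWeight_one (χ : MulChar (ZMod p) ℂ) (ψ : AddChar (ZMod p) ℂ)
    (s : Finset (ZMod p)) (h : (ZMod p)[X]) : charWeight χ ψ s h 1 = 1 := by
  simp [charWeight, rootSum_one]

lemma charWeight_pow (χ : MulChar (ZMod p) ℂ) (ψ : AddChar (ZMod p) ℂ)
    (s : Finset (ZMod p)) (h : (ZMod p)[X]) {P : (ZMod p)[X]} (hP : P ≠ 0) (k : ℕ) :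
    charWeight χ ψ s h (P ^ k) = charWeight χ ψ s h P ^ k := by
  induction k with
  | zero => simp [charWeight_one]
  | succ k ih => rw [pow_succ, charWeight_mul χ ψ s h (pow_ne_zero k hP) hP, ih, pow_succ]

open IntermediateField in
/-- The weight of a minimal polynomial computes the summand of the character sum. -/
lemma charWeight_minpoly_pow (χ : MulChar (ZMod p) ℂ) (ψ : AddChar (ZMod p) ℂ)
    (s : Finset (ZMod p)) (h : (ZMod p)[X]) (K : Type) [Field K] [Finite K] [Algebra (ZMod p) K]
    (x : K) :
    charWeight χ ψ s h (minpoly (ZMod p) x) ^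
        (Module.finrank (ZMod p) K / (minpoly (ZMod p) x).natDegree) =
      χ (Algebra.norm (ZMod p) (aeval x (∏ a ∈ s, (X - C a)))) *
        ψ (Algebra.trace (ZMod p) K (aeval x h)) := by
  set P := minpoly (ZMod p) x with hPdef
  have hx : IsIntegral (ZMod p) x := Algebra.IsIntegral.isIntegral x
  have hP : P.Monic := minpoly.monic hx
  have hk : Module.finrank (ZMod p) K / P.natDegree = Module.finrank (ZMod p)⟮x⟯ K := by
    rw [← Module.finrank_mul_finrank (ZMod p) (ZMod p)⟮x⟯ K, adjoin.finrank hx]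
    exact Nat.mul_div_cancel_left _ (minpoly.natDegree_pos hx)
  set E := AlgebraicClosure (ZMod p)
  have htr : Algebra.trace (ZMod p) K (aeval x h) =
      Module.finrank (ZMod p)⟮x⟯ K • rootSum h P := by
    apply (algebraMap (ZMod p) E).injective
    rw [trace_eq_sum_embeddings E, map_nsmul, algebraMap_rootSum h hP,
      ← sum_embeddings_eq_sum_aroots (ZMod p) K E]
    simp only [aeval_algHom_apply]
  have hnm : Algebra.norm (ZMod p) (aeval x (∏ a ∈ s, (X - C a))) =
      (∏ a ∈ s, ((-1) ^ P.natDegree * P.eval a)) ^ Module.finrank (ZMod p)⟮x⟯ K := by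
    apply (algebraMap (ZMod p) E).injective
    have h1 : ((P.aroots E).map fun y => aeval y (∏ a ∈ s, (X - C a))).prod =
        algebraMap (ZMod p) E (∏ a ∈ s, ((-1) ^ P.natDegree * P.eval a)) := by
      have h2 := prod_map_prod_sub_eq s (algebraMap (ZMod p) E) (P.aroots E)
      simp only [map_prod, map_sub, aeval_X, aeval_C]
      rw [h2, aroots, ← (IsAlgClosed.splits _).eq_prod_roots_of_monic (hP.map _),
        IsAlgClosed.card_roots_eq_natDegree, natDegree_map]
      simp [eval_map_algebraMap, aeval_algebraMap_apply]
    rw [Algebra.norm_eq_prod_embeddings (ZMod p) E, map_pow, ← h1,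
      ← prod_embeddings_eq_prod_aroots (ZMod p) K E]
    simp only [aeval_algHom_apply]
  rw [hk, htr, hnm, AddChar.map_nsmul_eq_pow, map_pow, charWeight, mul_pow]

end CharWeight

section MonicPolynomials

variable (F : Type*) [Field F] [Finite F]

lemma finite_setOf_monic_natDegree_eq (n : ℕ) :
    {P : F[X] | P.Monic ∧ P.natDegree = n}.Finite := by
  refine Set.Finite.of_injOn (f := fun P (i : Fin (n + 1)) => P.coeff i) (t := Set.univ)
    (fun _ _ => Set.mem_univ _) ?_ Set.finite_univ
  rintro P ⟨-, hP⟩ Q ⟨-, hQ⟩ hPQ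
  ext i
  by_cases hi : i < n + 1
  · exact congrFun hPQ ⟨i, hi⟩
  · rw [coeff_eq_zero_of_natDegree_lt (by omega), coeff_eq_zero_of_natDegree_lt (by omega)]

/-- The monic polynomials of degree `n` over a finite field. -/
noncomputable def monicOfDegree (n : ℕ) : Finset F[X] :=
  (finite_setOf_monic_natDegree_eq F n).toFinset

variable {F}

lemma mem_monicOfDegree {n : ℕ} {P : F[X]} :
    P ∈ monicOfDegree F n ↔ P.Monic ∧ P.natDegree = n := by
  simp [monicOfDegree]

variable (F) in
lemma finite_setOf_irreducible_dvd (n : ℕ) :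
    {P : F[X] | P.Monic ∧ Irreducible P ∧ P.natDegree ∣ n + 1}.Finite := by
  refine ((Set.finite_Iic (n + 1)).biUnion
    fun i _ => finite_setOf_monic_natDegree_eq F i).subset ?_
  rintro P ⟨hP, -, hd⟩
  simp only [Set.mem_iUnion]
  exact ⟨P.natDegree, Nat.le_of_dvd n.succ_pos hd, hP, rfl⟩

variable (F) in
lemma finite_setOf_irreducible_le (n : ℕ) :
    {P : F[X] | P.Monic ∧ Irreducible P ∧ P.natDegree ≤ n}.Finite := by
  refine ((Set.finite_Iic n).biUnion
    fun i _ => finite_setOf_monic_natDegree_eq F i).subset ?_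
  rintro P ⟨hP, -, hd⟩
  simp only [Set.mem_iUnion]
  exact ⟨P.natDegree, hd, hP, rfl⟩

variable (F) in
/-- The monic irreducible polynomials whose degree divides `n + 1`. -/
noncomputable def primesOfDegreeDvd (n : ℕ) : Finset F[X] :=
  (finite_setOf_irreducible_dvd F n).toFinset

lemma mem_primesOfDegreeDvd {n : ℕ} {P : F[X]} :
    P ∈ primesOfDegreeDvd F n ↔ P.Monic ∧ Irreducible P ∧ P.natDegree ∣ n + 1 := by
  simp [primesOfDegreeDvd]

lemma natDegree_eq_sum_count {P : F[X]} (hP : P.Monic) [DecidableEq F] :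
    P.natDegree = ∑ Q ∈ (finite_setOf_irreducible_le F P.natDegree).toFinset,
      (UniqueFactorizationMonoid.normalizedFactors P).count Q * Q.natDegree := by
  set S := UniqueFactorizationMonoid.normalizedFactors P with hS
  have hmon : ∀ Q ∈ S, Q.Monic := fun Q hQ => by
    rw [← UniqueFactorizationMonoid.normalize_normalized_factor Q hQ]
    exact monic_normalize (UniqueFactorizationMonoid.irreducible_of_normalized_factor Q hQ).ne_zero
  have hprod : S.prod = P := by
    have h1 := UniqueFactorizationMonoid.prod_normalizedFactors hP.ne_zero
    refine eq_of_monic_of_associated ?_ hP h1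
    have := monic_multiset_prod_of_monic S id (by simpa using hmon)
    simpa using this
  have h1 : P.natDegree = (S.map natDegree).sum := by
    conv_lhs => rw [← hprod]
    exact natDegree_multiset_prod_of_monic S hmon
  conv_lhs => rw [h1]
  rw [Finset.sum_multiset_map_count]
  simp only [smul_eq_mul]
  refine Finset.sum_subset ?_ ?_
  · intro Q hQ
    rw [Multiset.mem_toFinset] at hQ
    simp only [Set.Finite.mem_toFinset, Set.mem_ofPred_eq]
    refine ⟨hmon Q hQ, UniqueFactorizationMonoid.irreducible_of_normalized_factor Q hQ, ?_⟩
    exact natDegree_le_of_dvd (UniqueFactorizationMonoid.dvd_of_mem_normalizedFactors hQ) hP.ne_zero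
  · intro Q _ hQ
    rw [Multiset.mem_toFinset] at hQ
    rw [Multiset.count_eq_zero_of_notMem hQ, zero_mul]

lemma pow_dvd_iff_le_count {F : Type*} [Field F] {P Q : F[X]} (hP : P.Monic) (hQ : Q.Monic) (hQi : Irreducible Q)
    [DecidableEq F] (k : ℕ) :
    Q ^ k ∣ P ↔ k ≤ (UniqueFactorizationMonoid.normalizedFactors P).count Q := by
  rw [pow_dvd_iff_le_emultiplicity,
    UniqueFactorizationMonoid.emultiplicity_eq_count_normalizedFactors hQi hP.ne_zero,
    hQ.normalize_eq_self, Nat.cast_le]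

/-- The degree counts the prime power divisors weighted by the degree of the prime. -/
lemma sum_natDegree_of_pow_dvd {P : F[X]} (hP : P.Monic) [DecidableEq F]
    [DecidablePred fun Q : F[X] => Q ∣ P] :
    (∑ j ∈ Finset.range P.natDegree, ∑ Q ∈ primesOfDegreeDvd F j,
      if Q ^ ((j + 1) / Q.natDegree) ∣ P then Q.natDegree else 0) = P.natDegree := by
  rw [Finset.sum_comm' (t' := (finite_setOf_irreducible_le F P.natDegree).toFinset)
    (s' := fun Q => (Finset.range P.natDegree).filter fun j => Q.natDegree ∣ j + 1)]
  swap
  · intro j Q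
    simp only [Finset.mem_range, mem_primesOfDegreeDvd, Finset.mem_filter, Set.Finite.mem_toFinset,
      Set.mem_ofPred_eq]
    constructor
    · rintro ⟨h1, h2, h3, h4⟩
      exact ⟨⟨h1, h4⟩, h2, h3, (Nat.le_of_dvd j.succ_pos h4).trans h1⟩
    · rintro ⟨⟨h1, h4⟩, h2, h3, -⟩
      exact ⟨h1, h2, h3, h4⟩
  conv_rhs => rw [natDegree_eq_sum_count hP]
  refine Finset.sum_congr rfl fun Q hQ => ?_
  simp only [Set.Finite.mem_toFinset, Set.mem_ofPred_eq] at hQ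
  obtain ⟨hQm, hQi, hQd⟩ := hQ
  have hpos : 0 < Q.natDegree := hQi.natDegree_pos
  rw [← Finset.sum_filter, Finset.sum_const, smul_eq_mul]
  congr 1
  set v := (UniqueFactorizationMonoid.normalizedFactors P).count Q with hv
  have hvd : v * Q.natDegree ≤ P.natDegree := by
    rw [← hQm.natDegree_pow]
    exact natDegree_le_of_dvd ((pow_dvd_iff_le_count hP hQm hQi v).mpr le_rfl) hP.ne_zero
  conv_rhs => rw [← Finset.card_range v]
  refine Finset.card_bij' (fun j _ => (j + 1) / Q.natDegree - 1)
    (fun k _ => (k + 1) * Q.natDegree - 1) ?_ ?_ ?_ ?_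
  · intro j hj
    simp only [Finset.mem_filter, Finset.mem_range, pow_dvd_iff_le_count hP hQm hQi] at hj ⊢
    have : 0 < (j + 1) / Q.natDegree := Nat.div_pos (Nat.le_of_dvd j.succ_pos hj.1.2) hpos
    omega
  · intro k hk
    simp only [Finset.mem_filter, Finset.mem_range, pow_dvd_iff_le_count hP hQm hQi] at hk ⊢
    have h1 : (k + 1) * Q.natDegree ≤ v * Q.natDegree := Nat.mul_le_mul_right _ hk
    have h2 : 0 < (k + 1) * Q.natDegree := Nat.mul_pos k.succ_pos hpos
    rw [Nat.sub_add_cancel h2, Nat.mul_div_cancel _ hpos]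
    exact ⟨⟨by omega, dvd_mul_left _ _⟩, hk⟩
  · intro j hj
    simp only [Finset.mem_filter] at hj
    have : 0 < (j + 1) / Q.natDegree := Nat.div_pos (Nat.le_of_dvd j.succ_pos hj.1.2) hpos
    rw [Nat.sub_add_cancel this, Nat.div_mul_cancel hj.1.2, Nat.add_sub_cancel]
  · intro k _
    have h2 : 0 < (k + 1) * Q.natDegree := Nat.mul_pos k.succ_pos hpos
    rw [Nat.sub_add_cancel h2, Nat.mul_div_cancel _ hpos, Nat.add_sub_cancel]

/-- The coefficient of the `L`-series of a completely multiplicative weight. -/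
noncomputable def lCoeff (w : F[X] → ℂ) (n : ℕ) : ℂ := ∑ P ∈ monicOfDegree F n, w P

lemma sum_dvd_monicOfDegree (w : F[X] → ℂ)
    (hw : ∀ P Q : F[X], P ≠ 0 → Q ≠ 0 → w (P * Q) = w P * w Q) {R : F[X]} (hR : R.Monic) {n : ℕ}
    (hn : R.natDegree ≤ n) [DecidablePred fun P : F[X] => R ∣ P] :
    ∑ P ∈ (monicOfDegree F n).filter (R ∣ ·), w P = w R * lCoeff w (n - R.natDegree) := by
  rw [lCoeff, Finset.mul_sum]
  symm
  refine Finset.sum_bij (fun P _ => R * P) ?_ ?_ ?_ ?_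
  · intro P hP
    rw [mem_monicOfDegree] at hP
    rw [Finset.mem_filter, mem_monicOfDegree]
    refine ⟨⟨hR.mul hP.1, ?_⟩, dvd_mul_right _ _⟩
    rw [hR.natDegree_mul hP.1, hP.2]
    omega
  · intro P _ Q _ h
    exact mul_left_cancel₀ hR.ne_zero h
  · intro P hP
    rw [Finset.mem_filter, mem_monicOfDegree] at hP
    obtain ⟨⟨hP, hPn⟩, Q, rfl⟩ := hP
    have hQ := hR.of_mul_monic_left hP
    refine ⟨Q, ?_, rfl⟩
    rw [mem_monicOfDegree]
    rw [hR.natDegree_mul hQ] at hPn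
    exact ⟨hQ, by omega⟩
  · intro P hP
    rw [hw R P hR.ne_zero (mem_monicOfDegree.mp hP).1.ne_zero]

/-- The sum of the weight over prime powers of degree `j + 1`. -/
noncomputable def primePowerSum (w : F[X] → ℂ) (j : ℕ) : ℂ :=
  ∑ Q ∈ primesOfDegreeDvd F j, Q.natDegree * w Q ^ ((j + 1) / Q.natDegree)

/-- The logarithmic derivative of the Euler product. -/
theorem natCast_mul_lCoeff (w : F[X] → ℂ)
    (hw : ∀ P Q : F[X], P ≠ 0 → Q ≠ 0 → w (P * Q) = w P * w Q)
    (hwp : ∀ P : F[X], P ≠ 0 → ∀ k, w (P ^ k) = w P ^ k) (n : ℕ) :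
    n * lCoeff w n = ∑ j ∈ Finset.range n, primePowerSum w j * lCoeff w (n - (j + 1)) := by
  classical
  have h1 : n * lCoeff w n = ∑ P ∈ monicOfDegree F n, ∑ j ∈ Finset.range n,
      ∑ Q ∈ primesOfDegreeDvd F j,
        (if Q ^ ((j + 1) / Q.natDegree) ∣ P then (Q.natDegree : ℂ) else 0) * w P := by
    rw [lCoeff, Finset.mul_sum]
    refine Finset.sum_congr rfl fun P hP => ?_
    obtain ⟨hPm, rfl⟩ := mem_monicOfDegree.mp hP
    simp_rw [← Finset.sum_mul]
    congr 1
    have := congrArg (Nat.cast (R := ℂ)) (sum_natDegree_of_pow_dvd hPm)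
    rw [← this]
    push_cast
    rfl
  rw [h1, Finset.sum_comm]
  refine Finset.sum_congr rfl fun j hj => ?_
  rw [Finset.sum_comm, primePowerSum, Finset.sum_mul]
  refine Finset.sum_congr rfl fun Q hQ => ?_
  obtain ⟨hQm, hQi, hQd⟩ := mem_primesOfDegreeDvd.mp hQ
  have hdeg : (Q ^ ((j + 1) / Q.natDegree)).natDegree = j + 1 := by
    rw [hQm.natDegree_pow, Nat.div_mul_cancel hQd]
  have h2 := sum_dvd_monicOfDegree w hw (hQm.pow ((j + 1) / Q.natDegree)) (n := n)
    (by rw [hdeg]; exact Finset.mem_range.mp hj)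
  rw [hdeg, hwp Q hQm.ne_zero] at h2
  rw [mul_assoc, ← h2, Finset.sum_filter, Finset.mul_sum]
  refine Finset.sum_congr rfl fun P _ => ?_
  split_ifs <;> simp

end MonicPolynomials

lemma coeff_reflect_eq_zero {F : Type*} [Field F] {B : F[X]} {n k : ℕ} (h : B.natDegree + k < n) :
    (reflect n B).coeff k = 0 := by
  rw [coeff_reflect, revAt_le (by omega)]
  exact coeff_eq_zero_of_natDegree_lt (by omega)

lemma natDegree_add_of_lt {F : Type*} [Field F] {P B : F[X]} {n : ℕ} (hP : P.Monic)
    (hn : P.natDegree = n) (h : B.natDegree < n) : (P + B).Monic ∧ (P + B).natDegree = n := by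
  have hlt : B.degree < P.degree := by
    rw [degree_eq_natDegree hP.ne_zero, hn]
    exact (degree_le_natDegree).trans_lt (by exact_mod_cast h)
  refine ⟨hP.add_of_left hlt, ?_⟩
  rw [natDegree_eq_of_degree_eq (degree_add_eq_left_of_degree_lt hlt), hn]

lemma rootSum_add_of_lt {F : Type*} [Field F] {P B h : F[X]} {n : ℕ} (hP : P.Monic)
    (hn : P.natDegree = n) (hB : B.natDegree + h.natDegree < n) :
    rootSum h (P + B) = rootSum h P := by
  obtain ⟨h1, h2⟩ := natDegree_add_of_lt (B := B) hP hn (by omega)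
  have hdvd : X ^ (h.natDegree + 1) ∣ (P + B).reverse - P.reverse := by
    rw [reverse, reverse, h2, hn, reflect_add, add_sub_cancel_left, X_pow_dvd_iff]
    exact fun j hj => coeff_reflect_eq_zero (by omega)
  have hcoeff : ∀ k ∈ Finset.range h.natDegree,
      h.coeff (k + 1) * PowerSeries.coeff k (logDerivSeries (P + B)) =
        h.coeff (k + 1) * PowerSeries.coeff k (logDerivSeries P) := fun k hk => by
    rw [coeff_logDerivSeries_congr h1.ne_zero hP.ne_zero h.natDegree hdvd (Finset.mem_range.mp hk)]
  unfold rootSum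
  rw [h2, hn, Finset.sum_congr rfl hcoeff]

lemma sum_monicOfDegree_add {F : Type*} [Field F] [Finite F] (w : F[X] → ℂ) (B : F[X]) {n : ℕ}
    (hB : B.natDegree < n) : ∑ P ∈ monicOfDegree F n, w (P + B) = lCoeff w n := by
  rw [lCoeff]
  refine Finset.sum_bij' (fun P _ => P + B) (fun P _ => P - B) ?_ ?_ ?_ ?_ ?_
  · intro P hP
    rw [mem_monicOfDegree] at hP ⊢
    exact natDegree_add_of_lt hP.1 hP.2 hB
  · intro P hP
    rw [mem_monicOfDegree] at hP ⊢
    rw [sub_eq_add_neg]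
    exact natDegree_add_of_lt hP.1 hP.2 (by rwa [natDegree_neg])
  all_goals intros; simp

lemma lCoeff_zero {F : Type*} [Field F] [Finite F] (w : F[X] → ℂ) : lCoeff w 0 = w 1 := by
  have : monicOfDegree F 0 = {1} := by
    ext P
    rw [mem_monicOfDegree, Finset.mem_singleton]
    constructor
    · rintro ⟨h1, h2⟩
      exact h1.natDegree_eq_zero.mp h2
    · rintro rfl
      exact ⟨monic_one, natDegree_one⟩
  rw [lCoeff, this, Finset.sum_singleton]

lemma sum_mulChar_affine {F : Type*} [Field F] [Fintype F] {χ : MulChar F ℂ} (hχ : χ ≠ 1) (u : F)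
    {b : F} (hb : b ≠ 0) : ∑ c, χ (u + c * b) = 0 := by
  rw [← MulChar.sum_eq_zero_of_ne_one hχ]
  exact Fintype.sum_equiv ((Equiv.mulRight₀ b hb).trans (Equiv.addLeft u)) _ _ fun c => by simp

section LFunction

variable {p : ℕ} [Fact p.Prime]

/-- The `L`-function of a mixed character sum is a polynomial. -/
theorem lCoeff_charWeight_eq_zero {χ : MulChar (ZMod p) ℂ} (hχ : χ ≠ 1) (ψ : AddChar (ZMod p) ℂ)
    {s : Finset (ZMod p)} (hs : s.Nonempty) (h : (ZMod p)[X]) {n : ℕ}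
    (hn : s.card + h.natDegree ≤ n) : lCoeff (charWeight χ ψ s h) n = 0 := by
  obtain ⟨a₀, ha₀⟩ := hs
  set B : (ZMod p)[X] := ∏ a ∈ s.erase a₀, (X - C a) with hBdef
  have hBdeg : B.natDegree + 1 = s.card := by
    rw [hBdef, natDegree_finsetProd_X_sub_C_eq_card, Finset.card_erase_add_one ha₀]
  have hB0 : B.eval a₀ ≠ 0 := by
    rw [hBdef, eval_prod, Finset.prod_ne_zero_iff]
    intro a ha
    simp only [eval_sub, eval_X, eval_C]
    exact sub_ne_zero.mpr (Finset.ne_of_mem_erase ha).symm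
  have hBa : ∀ a ∈ s.erase a₀, B.eval a = 0 := by
    intro a ha
    rw [hBdef, eval_prod]
    exact Finset.prod_eq_zero ha (by simp)
  have hdeg : ∀ c : ZMod p, (C c * B).natDegree ≤ B.natDegree := fun c => natDegree_C_mul_le c B
  have h1 : (p : ℂ) * lCoeff (charWeight χ ψ s h) n =
      ∑ c : ZMod p, ∑ P ∈ monicOfDegree (ZMod p) n, charWeight χ ψ s h (P + C c * B) := by
    rw [Finset.sum_congr rfl fun c _ => sum_monicOfDegree_add (charWeight χ ψ s h) (C c * B)
      (n := n) (by have := hdeg c; omega)]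
    simp [ZMod.card]
  have h2 : (p : ℂ) * lCoeff (charWeight χ ψ s h) n = 0 := by
    rw [h1, Finset.sum_comm]
    refine Finset.sum_eq_zero fun P hP => ?_
    obtain ⟨hPm, hPn⟩ := mem_monicOfDegree.mp hP
    have h3 : ∀ c, charWeight χ ψ s h (P + C c * B) =
        χ (P.eval a₀ + c * B.eval a₀) * (χ ((-1) ^ n) *
          χ (∏ a ∈ s.erase a₀, ((-1) ^ n * P.eval a)) * ψ (rootSum h P)) := by
      intro c
      have hc := hdeg c
      rw [charWeight, rootSum_add_of_lt hPm hPn (by omega),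
        (natDegree_add_of_lt hPm hPn (by omega)).2, ← Finset.mul_prod_erase s _ ha₀]
      have : ∏ a ∈ s.erase a₀, ((-1) ^ n * (P + C c * B).eval a) =
          ∏ a ∈ s.erase a₀, ((-1) ^ n * P.eval a) :=
        Finset.prod_congr rfl fun a ha => by simp [hBa a ha]
      rw [this, map_mul, map_mul]
      simp only [eval_add, eval_mul, eval_C]
      ring
    simp_rw [h3]
    rw [← Finset.sum_mul, sum_mulChar_affine hχ _ hB0, zero_mul]
  exact (mul_eq_zero.mp h2).resolve_left (by exact_mod_cast (Fact.out : p.Prime).ne_zero)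

/-- The prime power sums are the mixed character sums over the finite extensions. -/
theorem primePowerSum_charWeight (χ : MulChar (ZMod p) ℂ) (ψ : AddChar (ZMod p) ℂ)
    (s : Finset (ZMod p)) (h : (ZMod p)[X]) (K : Type) [Field K] [Fintype K] [Algebra (ZMod p) K]
    {j : ℕ} (hj : Module.finrank (ZMod p) K = j + 1) :
    primePowerSum (charWeight χ ψ s h) j = mixedSum χ ψ (∏ a ∈ s, (X - C a)) h K := by
  classical
  have hint : ∀ x : K, IsIntegral (ZMod p) x := fun x => Algebra.IsIntegral.isIntegral x
  have hmaps : ∀ x ∈ (Finset.univ : Finset K), minpoly (ZMod p) x ∈ primesOfDegreeDvd (ZMod p) j := by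
    intro x _
    rw [mem_primesOfDegreeDvd, ← hj]
    exact ⟨minpoly.monic (hint x), minpoly.irreducible (hint x), minpoly.degree_dvd (hint x)⟩
  rw [mixedSum, ← Finset.sum_fiberwise_of_maps_to hmaps, primePowerSum]
  refine Finset.sum_congr rfl fun Q hQ => ?_
  obtain ⟨hQm, hQi, hQd⟩ := mem_primesOfDegreeDvd.mp hQ
  have hfib : ∀ x ∈ Finset.univ.filter (fun x : K => minpoly (ZMod p) x = Q),
      χ (Algebra.norm (ZMod p) (aeval x (∏ a ∈ s, (X - C a)))) *
        ψ (Algebra.trace (ZMod p) K (aeval x h)) =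
      charWeight χ ψ s h Q ^ ((j + 1) / Q.natDegree) := by
    intro x hx
    rw [← charWeight_minpoly_pow, (Finset.mem_filter.mp hx).2, hj]
  rw [Finset.sum_congr rfl hfib, Finset.sum_const, nsmul_eq_mul]
  congr 2
  have hcard : Fintype.card K = p ^ (j + 1) := by
    rw [Module.card_eq_pow_finrank (K := ZMod p), ZMod.card, hj]
  have hdvd : Q ∣ X ^ Fintype.card K - X := by
    have := (hQi.natDegree_dvd_iff_dvd_X_pow_card_pow_sub_X).mp hQd
    rwa [Nat.card_eq_fintype_card, ZMod.card, ← hcard] at this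
  have hsplit : (Q.map (algebraMap (ZMod p) K)).Splits :=
    (FiniteField.splits_X_pow_card_sub_X p (K := K)).of_dvd
      (map_ne_zero (FiniteField.X_pow_card_sub_X_ne_zero _ Fintype.one_lt_card))
      (map_dvd (mapRingHom (algebraMap (ZMod p) K)) hdvd)
  have hroot := card_rootSet_eq_natDegree (PerfectField.separable_of_irreducible hQi) hsplit
  rw [← hroot, ← Set.toFinset_card]
  congr 1
  ext x
  rw [Finset.mem_filter, Set.mem_toFinset, hQm.mem_rootSet]
  constructor
  · exact fun hx => ⟨Finset.mem_univ _, (minpoly.eq_of_irreducible_of_monic hQi hx hQm).symm⟩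
  · rintro ⟨-, rfl⟩
    exact minpoly.aeval _ _

end LFunction

/-- A sequence satisfying the logarithmic derivative recursion of a polynomial consists of
power sums. -/
lemma exists_powerSum_of_recursion (L S : ℕ → ℂ) (D : ℕ) (h0 : L 0 = 1) (hL : ∀ n, D < n → L n = 0)
    (hrec : ∀ n : ℕ, n * L n = ∑ j ∈ Finset.range n, S j * L (n - (j + 1))) :
    ∃ ω : Multiset ℂ, ω.card = D ∧ ∀ k, S k = -(ω.map (· ^ (k + 1))).sum := by
  set Q : ℂ[X] := ∑ n ∈ Finset.range (D + 1), monomial n (L n) with hQ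
  have hQc : ∀ n, Q.coeff n = L n := by
    intro n
    rw [hQ, finsetSum_coeff]
    simp only [coeff_monomial, Finset.sum_ite_eq', Finset.mem_range]
    split_ifs with h
    · rfl
    · exact (hL n (by omega)).symm
  have hQd : Q.natDegree ≤ D := natDegree_le_iff_coeff_eq_zero.mpr fun n hn => by rw [hQc, hL n hn]
  set P := reflect D Q with hP
  have hPD : P.coeff D = 1 := by rw [hP, coeff_reflect, revAt_le le_rfl, Nat.sub_self, hQc, h0]
  have hPd : P.natDegree ≤ D := natDegree_le_iff_coeff_eq_zero.mpr fun n hn => by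
    rw [hP, coeff_reflect, revAt_eq_self_of_lt hn, hQc, hL n hn]
  have hPm : P.Monic := monic_of_natDegree_le_of_coeff_eq_one D hPd hPD
  have hPn : P.natDegree = D :=
    le_antisymm hPd (le_natDegree_of_ne_zero (by rw [hPD]; exact one_ne_zero))
  have hrev : P.reverse = Q := by
    rw [reverse, hPn, hP]
    ext n
    rw [coeff_reflect, coeff_reflect, revAt_invol]
  have hlog : logDerivSeries P = -PowerSeries.mk S := by
    rw [logDerivSeries_eq_iff hPm.ne_zero, hrev, neg_mul, neg_inj]
    ext m
    rw [PowerSeries.coeff_mul, coeff_coe, coeff_derivative, hQc,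
      Finset.Nat.sum_antidiagonal_eq_sum_range_succ_mk, mul_comm]
    have := hrec (m + 1)
    push_cast at this
    rw [this]
    refine Finset.sum_congr rfl fun j hj => ?_
    rw [PowerSeries.coeff_mk, coeff_coe, hQc]
  refine ⟨P.roots, ?_, fun k => ?_⟩
  · rw [IsAlgClosed.card_roots_eq_natDegree, hPn]
  · rw [← coeff_logDerivSeries_of_splits hPm (IsAlgClosed.splits P), hlog]
    simp

/-- Exponential growth of power sums controls every term. -/
lemma norm_le_of_norm_powerSum_le (Z : Multiset ℂ) {B c : ℝ} (hB : 0 < B) (m₀ : ℕ)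
    (h : ∀ m ≥ m₀, ‖(Z.map (· ^ m)).sum‖ ≤ c * B ^ m) {z : ℂ} (hz : z ∈ Z) : ‖z‖ ≤ B := by
  classical
  by_contra! hlt
  set q : ℂ[X] := ∏ y ∈ Z.toFinset.erase z, (X - C y) with hq
  have hqz : q.eval z ≠ 0 := by
    rw [hq, eval_prod, Finset.prod_ne_zero_iff]
    intro y hy
    simp only [eval_sub, eval_X, eval_C]
    exact sub_ne_zero.mpr (Finset.ne_of_mem_erase hy).symm
  have hsum : ∀ m, ∑ k ∈ Finset.range (q.natDegree + 1), q.coeff k * (Z.map (· ^ (m + k))).sum =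
      Z.count z * (z ^ m * q.eval z) := by
    intro m
    have h1 : ∀ k, q.coeff k * (Z.map (· ^ (m + k))).sum =
        ∑ y ∈ Z.toFinset, (Z.count y : ℂ) * (y ^ m * (q.coeff k * y ^ k)) := by
      intro k
      rw [Finset.sum_multiset_map_count, Finset.mul_sum]
      refine Finset.sum_congr rfl fun y _ => ?_
      rw [nsmul_eq_mul, pow_add]
      ring
    simp_rw [h1]
    rw [Finset.sum_comm]
    simp_rw [← Finset.mul_sum, ← eval_eq_sum_range]
    refine Finset.sum_eq_single_of_mem z (Multiset.mem_toFinset.mpr hz) fun y hy hne => ?_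
    rw [hq, eval_prod, Finset.prod_eq_zero (Finset.mem_erase.mpr ⟨hne, hy⟩) (by simp)]
    ring
  set c' : ℝ := ∑ k ∈ Finset.range (q.natDegree + 1), ‖q.coeff k‖ * (c * B ^ k) with hc'
  have hcount : (1 : ℝ) ≤ Z.count z := by
    exact_mod_cast Multiset.one_le_count_iff_mem.mpr hz
  have hbound : ∀ m ≥ m₀, ‖z‖ ^ m * ‖q.eval z‖ ≤ c' * B ^ m := by
    intro m hm
    calc ‖z‖ ^ m * ‖q.eval z‖ ≤ Z.count z * (‖z‖ ^ m * ‖q.eval z‖) :=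
          le_mul_of_one_le_left (by positivity) hcount
      _ = ‖∑ k ∈ Finset.range (q.natDegree + 1), q.coeff k * (Z.map (· ^ (m + k))).sum‖ := by
          rw [hsum]; simp
      _ ≤ ∑ k ∈ Finset.range (q.natDegree + 1), ‖q.coeff k‖ * (c * B ^ (m + k)) := by
          refine norm_sum_le_of_le _ fun k _ => ?_
          rw [norm_mul]
          exact mul_le_mul_of_nonneg_left (h _ (by omega)) (norm_nonneg _)
      _ = c' * B ^ m := by
          rw [hc', Finset.sum_mul]
          refine Finset.sum_congr rfl fun k _ => ?_
          ring
  have hqpos : 0 < ‖q.eval z‖ := norm_pos_iff.mpr hqz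
  have hr : 1 < ‖z‖ / B := (one_lt_div hB).mpr hlt
  obtain ⟨m, hm⟩ := ((tendsto_pow_atTop_atTop_of_one_lt hr).eventually_gt_atTop
    (c' / ‖q.eval z‖)).and (Filter.eventually_ge_atTop m₀) |>.exists
  have h2 := hbound m hm.2
  have h3 := hm.1
  rw [div_pow, div_lt_div_iff₀ hqpos (by positivity)] at h3
  linarith

section CompleteSum

variable {p : ℕ} [Fact p.Prime]

/-- The Weil bound over the prime field, for `0 < deg h < p`. -/
lemma norm_sum_mulChar_addChar_le_of_pos (hp2 : 2 < p) {χ : MulChar (ZMod p) ℂ} (hχ : χ ≠ 1)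
    (ψ : AddChar (ZMod p) ℂ) {s : Finset (ZMod p)} (hs : s.Nonempty) {h : (ZMod p)[X]}
    (hh : 0 < h.natDegree) (hhp : h.natDegree < p) :
    ‖∑ x, χ (∏ a ∈ s, (x - a)) * ψ (h.eval x)‖ ≤ (s.card + h.natDegree : ℕ) * √p := by
  obtain ⟨α, hα⟩ := hs
  set w := charWeight χ ψ s h with hw
  obtain ⟨ω, hcard, hω⟩ := exists_powerSum_of_recursion (lCoeff w) (primePowerSum w)
    (s.card + h.natDegree - 1) (by rw [lCoeff_zero, hw, charWeight_one])
    (fun n hn => lCoeff_charWeight_eq_zero hχ ψ ⟨α, hα⟩ h (by omega))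
    (natCast_mul_lCoeff w (fun P Q hP hQ => charWeight_mul χ ψ s h hP hQ)
      fun P hP k => charWeight_pow χ ψ s h hP k)
  have hp0 : (0 : ℝ) < p := by exact_mod_cast (by omega : 0 < p)
  have hprod : ∏ a ∈ s, (X - C a) = (X - C α) * ∏ a ∈ s.erase α, (X - C a) :=
    (Finset.mul_prod_erase s _ hα).symm
  have heval : (∏ a ∈ s.erase α, (X - C a)).eval α ≠ 0 := by
    rw [eval_prod, Finset.prod_ne_zero_iff]
    intro y hy
    simp only [eval_sub, eval_X, eval_C]
    exact sub_ne_zero.mpr (Finset.ne_of_mem_erase hy).symm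
  obtain ⟨c, m₀, hc⟩ := norm_mixedSum_le_of_stepanov p hp2 _ h α heval hh hhp χ hχ ψ
  rw [← hprod] at hc
  have hnorm : ∀ z ∈ ω, ‖z‖ ≤ √p := by
    intro z hz
    have h1 : ‖z ^ 2‖ ≤ p := by
      refine norm_le_of_norm_powerSum_le (ω.map (· ^ 2)) hp0 (max m₀ 1) (c := c) (fun m hm => ?_)
        (Multiset.mem_map_of_mem _ hz)
      have hm0 : 2 * m ≠ 0 := by have := le_of_max_le_right hm; omega
      have hfin : Finite (GaloisField p (2 * m)) := inferInstance
      let _ : Fintype (GaloisField p (2 * m)) := Fintype.ofFinite _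
      have hfr : Module.finrank (ZMod p) (GaloisField p (2 * m)) = (2 * m - 1) + 1 := by
        rw [GaloisField.finrank p hm0]; omega
      have h2 := hc m (le_of_max_le_left hm) (GaloisField p (2 * m)) (by
        rw [← Nat.card_eq_fintype_card, GaloisField.card p _ hm0])
      rw [← primePowerSum_charWeight χ ψ s h (GaloisField p (2 * m)) hfr, ← hw, hω, norm_neg,
        Nat.sub_add_cancel (by omega)] at h2
      rw [Multiset.map_map]
      simpa [Function.comp_def, ← pow_mul] using h2
    rw [norm_pow] at h1
    exact Real.le_sqrt_of_sq_le h1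
  have hS : ∑ x, χ (∏ a ∈ s, (x - a)) * ψ (h.eval x) = -ω.sum := by
    have h1 := primePowerSum_charWeight χ ψ s h (ZMod p) (j := 0) (by simp)
    rw [← hw, hω, mixedSum] at h1
    simp only [zero_add, pow_one, Multiset.map_id'] at h1
    rw [h1]
    refine Finset.sum_congr rfl fun x _ => ?_
    simp [Algebra.norm_self, Algebra.trace_self]
  rw [hS, norm_neg]
  have hsum : ‖ω.sum‖ ≤ ω.card * √p := by
    clear hcard hω hS
    induction ω using Multiset.induction with
    | empty => simp
    | cons a t ih =>
      rw [Multiset.sum_cons, Multiset.card_cons]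
      have h1 := ih fun z hz => hnorm z (Multiset.mem_cons_of_mem hz)
      have h2 := hnorm a (Multiset.mem_cons_self a t)
      push_cast
      linarith [norm_add_le a t.sum]
  refine hsum.trans ?_
  rw [hcard]
  gcongr
  omega

/-- The Weil bound for mixed character sums over the prime field. -/
theorem norm_sum_mulChar_addChar_le (hp2 : 2 < p) {χ : MulChar (ZMod p) ℂ} (hχ : χ ≠ 1)
    (ψ : AddChar (ZMod p) ℂ) {s : Finset (ZMod p)} (hs : s.Nonempty) {h : (ZMod p)[X]}
    (hhp : h.natDegree < p) :
    ‖∑ x, χ (∏ a ∈ s, (x - a)) * ψ (h.eval x)‖ ≤ (s.card + h.natDegree + 1 : ℕ) * √p := by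
  rcases Nat.eq_zero_or_pos h.natDegree with h0 | hpos
  · rw [eq_C_of_natDegree_eq_zero h0]
    have h1 := norm_sum_mulChar_addChar_le_of_pos hp2 hχ 1 hs (h := X) (by simp)
      (by rw [natDegree_X]; omega)
    simp only [AddChar.one_apply, mul_one, natDegree_X] at h1
    simp only [eval_C, natDegree_C, ← Finset.sum_mul, norm_mul]
    rw [AddChar.norm_apply, mul_one]
    exact h1
  · refine (norm_sum_mulChar_addChar_le_of_pos hp2 hχ ψ hs hpos hhp).trans ?_
    exact mul_le_mul_of_nonneg_right (by exact_mod_cast Nat.le_succ _) (Real.sqrt_nonneg _)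

end CompleteSum

section Completion

variable {p : ℕ} [Fact p.Prime]

/-- The completion identity for an incomplete sum. -/
lemma natCast_mul_sum_eq_sum_fourier (F : ZMod p → ℂ) (J : Finset ℕ) :
    (p : ℂ) * ∑ n ∈ J, F n = ∑ a : ZMod p, (∑ x, F x * ZMod.stdAddChar (-(a * x))) *
      ∑ n ∈ J, ZMod.stdAddChar (a * (n : ZMod p)) := by
  have h1 : ∀ n x : ZMod p,
      ∑ a : ZMod p, (ZMod.stdAddChar (-(a * x)) * ZMod.stdAddChar (a * n) : ℂ) =
      if n - x = 0 then (p : ℂ) else 0 := by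
    intro n x
    have := AddChar.sum_mulShift (n - x) (ZMod.isPrimitive_stdAddChar p)
    rw [ZMod.card, Nat.cast_ite, Nat.cast_zero] at this
    rw [← this]
    refine Finset.sum_congr rfl fun a _ => ?_
    rw [← AddChar.map_add_eq_mul]
    congr 1
    ring
  simp_rw [Finset.sum_mul, Finset.mul_sum]
  rw [Finset.sum_comm]
  simp_rw [mul_assoc]
  rw [Finset.sum_congr rfl fun x _ => Finset.sum_comm]
  simp_rw [← Finset.mul_sum, h1, Finset.mul_sum]
  rw [Finset.sum_comm]
  refine Finset.sum_congr rfl fun n _ => ?_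
  rw [Finset.sum_eq_single (n : ZMod p)]
  · rw [if_pos (sub_self _), mul_comm]
  · intro x _ hx
    rw [if_neg (sub_ne_zero.mpr hx.symm), mul_zero]
  · simp

lemma four_mul_le_norm_stdAddChar_sub_one {k : ℕ} (hk : 0 < k) (hkp : k < p) :
    4 * min (k : ℝ) (p - k) / p ≤ ‖(ZMod.stdAddChar (k : ZMod p) : ℂ) - 1‖ := by
  have hp : (0 : ℝ) < p := by exact_mod_cast (by omega : 0 < p)
  have hk0 : (0 : ℝ) < k := by exact_mod_cast hk
  have hkp' : (k : ℝ) < p := by exact_mod_cast hkp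
  have h1 : (ZMod.stdAddChar (k : ZMod p) : ℂ) =
      Complex.exp (Complex.I * (2 * (Real.pi * k / p) : ℝ)) := by
    have := ZMod.stdAddChar_coe (N := p) (k : ℤ)
    push_cast at this
    rw [this]
    congr 1
    push_cast
    ring
  have hpi := Real.pi_pos
  have hx : 2 / Real.pi * (Real.pi * k / p) = 2 * k / p := by field_simp
  have hx' : 2 / Real.pi * (Real.pi - Real.pi * k / p) = 2 * (p - k) / p := by field_simp
  have hsin : 2 * min (k : ℝ) (p - k) / p ≤ Real.sin (Real.pi * k / p) := by
    rcases le_total (2 * (k : ℝ)) p with h | h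
    · have h2 : Real.pi * k / p ≤ Real.pi / 2 := by
        rw [div_le_div_iff₀ hp two_pos]; nlinarith
      refine le_trans ?_ (Real.mul_le_sin (by positivity) h2)
      rw [hx]
      gcongr
      exact min_le_left _ _
    · have h2 : Real.pi - Real.pi * k / p ≤ Real.pi / 2 := by
        have : Real.pi / 2 ≤ Real.pi * k / p := by
          rw [div_le_div_iff₀ two_pos hp]; nlinarith
        linarith
      have h3 : 0 ≤ Real.pi - Real.pi * k / p := by
        rw [sub_nonneg, div_le_iff₀ hp]; nlinarith
      rw [← Real.sin_pi_sub]
      refine le_trans ?_ (Real.mul_le_sin h3 h2)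
      rw [hx']
      gcongr
      exact min_le_right _ _
  rw [h1, Complex.norm_exp_I_mul_ofReal_sub_one, mul_div_cancel_left₀ _ two_ne_zero, norm_mul,
    Real.norm_eq_abs, Real.norm_eq_abs, abs_two]
  have h4 : 4 * min (k : ℝ) (p - k) / p = 2 * (2 * min (k : ℝ) (p - k) / p) := by ring
  rw [h4]
  gcongr
  exact hsin.trans (le_abs_self _)

lemma norm_sum_stdAddChar_le {k : ℕ} (hk : 0 < k) (hkp : k < p) {u v : ℕ} (huv : u ≤ v) :
    ‖∑ n ∈ Finset.Ico u v, (ZMod.stdAddChar ((k : ZMod p) * (n : ZMod p)) : ℂ)‖ ≤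
      p / 2 * (1 / k + 1 / (p - k)) := by
  have hp : (0 : ℝ) < p := by exact_mod_cast (by omega : 0 < p)
  have hk0 : (0 : ℝ) < k := by exact_mod_cast hk
  have hkp' : (0 : ℝ) < p - k := sub_pos.mpr (by exact_mod_cast hkp)
  set z : ℂ := ZMod.stdAddChar (k : ZMod p) with hz
  have hz1 : ‖z‖ = 1 := AddChar.norm_apply _ _
  have h1 : ∀ n : ℕ, (ZMod.stdAddChar ((k : ZMod p) * (n : ZMod p)) : ℂ) = z ^ n := by
    intro n
    rw [hz, ← AddChar.map_nsmul_eq_pow, nsmul_eq_mul, mul_comm]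
  simp_rw [h1]
  have h2 := congrArg norm (geom_sum_Ico_mul z huv)
  rw [norm_mul] at h2
  have h3 : ‖z ^ v - z ^ u‖ ≤ 2 := by
    refine (norm_sub_le _ _).trans ?_
    rw [norm_pow, norm_pow, hz1]
    norm_num
  have h4 := four_mul_le_norm_stdAddChar_sub_one hk hkp
  have hmin : 0 < min (k : ℝ) (p - k) := lt_min hk0 hkp'
  have h5 : ‖∑ n ∈ Finset.Ico u v, z ^ n‖ * (4 * min (k : ℝ) (p - k) / p) ≤ 2 :=
    (mul_le_mul_of_nonneg_left h4 (norm_nonneg _)).trans (h2 ▸ h3)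
  have h6 : ‖∑ n ∈ Finset.Ico u v, z ^ n‖ ≤ p / 2 * (1 / min (k : ℝ) (p - k)) := by
    rw [← le_div_iff₀ (by positivity)] at h5
    refine h5.trans (le_of_eq ?_)
    field_simp
    norm_num
  refine h6.trans ?_
  gcongr
  rcases min_choice (k : ℝ) (p - k) with h | h <;> rw [h]
  · exact le_add_of_nonneg_right (by positivity)
  · exact le_add_of_nonneg_left (by positivity)

lemma sum_inv_le_one_add_log (n : ℕ) :
    ∑ k ∈ Finset.range n, 1 / ((k : ℝ) + 1) ≤ 1 + Real.log n := by
  refine le_trans (le_of_eq ?_) (harmonic_le_one_add_log n)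
  rw [harmonic]
  push_cast
  simp

lemma sum_norm_sum_stdAddChar_le {u v : ℕ} (huv : u ≤ v) (hv : v ≤ u + p) :
    ∑ a : ZMod p, ‖∑ n ∈ Finset.Ico u v, (ZMod.stdAddChar (a * (n : ZMod p)) : ℂ)‖ ≤
      p * (2 + Real.log p) := by
  have hp : 1 < p := (Fact.out : p.Prime).one_lt
  obtain ⟨q, rfl⟩ : ∃ q, p = q + 1 := ⟨p - 1, by omega⟩
  have h1 : ∑ a : ZMod (q + 1), ‖∑ n ∈ Finset.Ico u v, (ZMod.stdAddChar (a * (n : ZMod (q + 1))) : ℂ)‖ =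
      ∑ k ∈ Finset.range (q + 1),
        ‖∑ n ∈ Finset.Ico u v, (ZMod.stdAddChar ((k : ZMod (q + 1)) * (n : ZMod (q + 1))) : ℂ)‖ :=
    Finset.sum_bij' (fun a _ => a.val) (fun k _ => (k : ZMod (q + 1)))
      (fun a _ => Finset.mem_range.mpr (ZMod.val_lt a)) (fun _ _ => Finset.mem_univ _)
      (fun a _ => ZMod.natCast_zmod_val a)
      (fun k hk => ZMod.val_cast_of_lt (Finset.mem_range.mp hk))
      (fun a _ => by rw [ZMod.natCast_zmod_val])
  rw [h1, Finset.sum_range_succ']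
  have h2 : ‖∑ n ∈ Finset.Ico u v, (ZMod.stdAddChar (((0 : ℕ) : ZMod (q + 1)) * (n : ZMod (q + 1))) : ℂ)‖ ≤
      ((q + 1 : ℕ) : ℝ) := by
    simp only [Nat.cast_zero, zero_mul, AddChar.map_zero_eq_one, Finset.sum_const, Nat.card_Ico,
      nsmul_eq_mul, mul_one, Complex.norm_natCast]
    exact_mod_cast (by omega : v - u ≤ q + 1)
  have h3 : ∀ k ∈ Finset.range q,
      ‖∑ n ∈ Finset.Ico u v, (ZMod.stdAddChar (((k + 1 : ℕ) : ZMod (q + 1)) * (n : ZMod (q + 1))) : ℂ)‖ ≤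
      ((q + 1 : ℕ) : ℝ) / 2 * (1 / ((k : ℝ) + 1) + 1 / (((q - 1 - k : ℕ) : ℝ) + 1)) := by
    intro k hk
    rw [Finset.mem_range] at hk
    refine (norm_sum_stdAddChar_le k.succ_pos (by omega) huv).trans (le_of_eq ?_)
    rw [Nat.cast_sub (by omega), Nat.cast_sub (by omega)]
    push_cast
    congr 3
    ring
  have h4 := Finset.sum_le_sum h3
  rw [← Finset.mul_sum, Finset.sum_add_distrib,
    Finset.sum_range_reflect (fun k : ℕ => 1 / ((k : ℝ) + 1)) q] at h4
  have h5 := sum_inv_le_one_add_log q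
  have h6 : Real.log q ≤ Real.log ((q + 1 : ℕ) : ℝ) :=
    Real.log_le_log (by exact_mod_cast (by omega : 0 < q)) (by exact_mod_cast q.le_succ)
  have hq : (0 : ℝ) < ((q + 1 : ℕ) : ℝ) := by exact_mod_cast q.succ_pos
  nlinarith

/-- An incomplete sum is bounded by the twisted complete sums up to a logarithm. -/
theorem norm_sum_Ico_le_of_complete (F : ZMod p → ℂ) {B : ℝ}
    (hB : ∀ a : ZMod p, ‖∑ x, F x * ZMod.stdAddChar (-(a * x))‖ ≤ B) {u v : ℕ} (huv : u ≤ v)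
    (hv : v ≤ u + p) : ‖∑ n ∈ Finset.Ico u v, F n‖ ≤ B * (2 + Real.log p) := by
  have hp : (0 : ℝ) < p := by exact_mod_cast (Fact.out : p.Prime).pos
  have hB0 : 0 ≤ B := (norm_nonneg _).trans (hB 0)
  have h1 := congrArg norm (natCast_mul_sum_eq_sum_fourier F (Finset.Ico u v))
  rw [norm_mul, Complex.norm_natCast] at h1
  have h2 : (p : ℝ) * ‖∑ n ∈ Finset.Ico u v, F n‖ ≤ B * (p * (2 + Real.log p)) := by
    rw [h1]
    refine (norm_sum_le _ _).trans ?_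
    refine le_trans ?_ (mul_le_mul_of_nonneg_left (sum_norm_sum_stdAddChar_le huv hv) hB0)
    rw [Finset.mul_sum]
    refine Finset.sum_le_sum fun a _ => ?_
    rw [norm_mul]
    exact mul_le_mul_of_nonneg_right (hB a) (norm_nonneg _)
  nlinarith

end Completion

section VanDerCorput

lemma sum_Ico_shift (y : ℤ → ℂ) {N K : ℕ} (hy : ∀ n, n ∉ Finset.Ico (0 : ℤ) N → y n = 0) {k : ℕ}
    (hk : k ≤ K) : ∑ m ∈ Finset.Ico (0 : ℤ) (N + K), y (m - k) = ∑ m ∈ Finset.Ico (0 : ℤ) N, y m := by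
  symm
  refine Finset.sum_of_injOn (· + (k : ℤ)) (fun a _ b _ h => by simpa using h) ?_ ?_ ?_
  · intro m hm
    simp only [Finset.coe_Ico, Set.mem_Ico] at hm ⊢
    omega
  · intro m _ hm
    refine hy _ fun h => hm ⟨m - k, h, ?_⟩
    simp
  · intro m _
    simp

/-- The van der Corput inequality, with a uniform bound for the correlations. -/
theorem sq_norm_sum_le_of_correlation (y : ℤ → ℂ) {N K : ℕ} {E : ℝ} (hE : 0 ≤ E)
    (hy : ∀ n, n ∉ Finset.Ico (0 : ℤ) N → y n = 0) (hy1 : ∀ n, ‖y n‖ ≤ 1)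
    (hcor : ∀ j : ℕ, 0 < j → j < K →
      ‖∑ n ∈ Finset.Ico (0 : ℤ) N, y (n + j) * starRingEnd ℂ (y n)‖ ≤ E) :
    (K : ℝ) ^ 2 * ‖∑ n ∈ Finset.Ico (0 : ℤ) N, y n‖ ^ 2 ≤ (N + K) * (K * N + K ^ 2 * E) := by
  set I := Finset.Ico (0 : ℤ) (N + K) with hI
  have hIcard : (I.card : ℝ) = N + K := by
    rw [hI, Int.card_Ico, sub_zero]
    exact_mod_cast congrArg Nat.cast (Int.toNat_natCast (N + K))
  set b : ℤ → ℂ := fun m => ∑ k ∈ Finset.range K, y (m - k) with hb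
  have h1 : (K : ℂ) * ∑ n ∈ Finset.Ico (0 : ℤ) N, y n = ∑ m ∈ I, b m := by
    rw [hb, Finset.sum_comm, Finset.sum_congr rfl fun k hk =>
      sum_Ico_shift y hy (Finset.mem_range.mp hk).le]
    simp
  have hc : ∀ k l : ℕ, k < l → l < K →
      ‖∑ m ∈ I, y (m - k) * starRingEnd ℂ (y (m - l))‖ ≤ E := by
    intro k l hkl hl
    have := sum_Ico_shift (fun n => y (n + (l - k : ℕ)) * starRingEnd ℂ (y n)) (N := N) (K := K)
      (fun n hn => by rw [hy n hn, map_zero, mul_zero]) hl.le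
    have h2 := hcor (l - k) (by omega) (by omega)
    rw [← this] at h2
    convert h2 using 3 with m _
    rw [Nat.cast_sub hkl.le]
    congr 2
    ring
  have hc' : ∀ k ∈ Finset.range K, ∀ l ∈ Finset.range K,
      ‖∑ m ∈ I, y (m - k) * starRingEnd ℂ (y (m - l))‖ ≤ (if k = l then (N : ℝ) else 0) + E := by
    intro k hk l hl
    rw [Finset.mem_range] at hk hl
    rcases lt_trichotomy k l with h | rfl | h
    · rw [if_neg h.ne, zero_add]
      exact hc k l h hl
    · rw [if_pos rfl]
      have := sum_Ico_shift (fun n => y n * starRingEnd ℂ (y n)) (N := N) (K := K)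
        (fun n hn => by rw [hy n hn, map_zero, mul_zero]) hk.le
      rw [this]
      refine le_add_of_le_of_nonneg ?_ hE
      refine (norm_sum_le_of_le _ (f := fun n => y n * starRingEnd ℂ (y n)) (n := fun _ => (1 : ℝ))
        fun n _ => ?_).trans ?_
      · rw [norm_mul, RCLike.norm_conj]
        exact mul_le_one₀ (hy1 n) (norm_nonneg _) (hy1 n)
      · simp
    · rw [if_neg h.ne', zero_add, ← Complex.norm_conj, map_sum]
      have := hc l k h hk
      convert this using 3 with m _
      rw [map_mul, Complex.conj_conj, mul_comm]
  have h2 : ∑ m ∈ I, ‖b m‖ ^ 2 ≤ K * N + K ^ 2 * E := by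
    have h3 : ((∑ m ∈ I, ‖b m‖ ^ 2 : ℝ) : ℂ) = ∑ k ∈ Finset.range K, ∑ l ∈ Finset.range K,
        ∑ m ∈ I, y (m - k) * starRingEnd ℂ (y (m - l)) := by
      push_cast
      simp_rw [← Complex.mul_conj', hb, map_sum, Finset.sum_mul_sum]
      rw [Finset.sum_comm]
      exact Finset.sum_congr rfl fun k _ => Finset.sum_comm
    calc ∑ m ∈ I, ‖b m‖ ^ 2 ≤ ‖((∑ m ∈ I, ‖b m‖ ^ 2 : ℝ) : ℂ)‖ := by
          rw [Complex.norm_real]; exact le_abs_self _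
      _ ≤ ∑ k ∈ Finset.range K, ∑ l ∈ Finset.range K, ((if k = l then (N : ℝ) else 0) + E) := by
          rw [h3]
          exact norm_sum_le_of_le _ fun k hk => norm_sum_le_of_le _ fun l hl => hc' k hk l hl
      _ = K * N + K ^ 2 * E := by
          simp only [Finset.sum_add_distrib, Finset.sum_ite_eq]
          rw [Finset.sum_congr rfl fun k hk => if_pos hk]
          simp
          ring
  calc (K : ℝ) ^ 2 * ‖∑ n ∈ Finset.Ico (0 : ℤ) N, y n‖ ^ 2 = ‖∑ m ∈ I, b m‖ ^ 2 := by
        rw [← h1, norm_mul, Complex.norm_natCast, mul_pow]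
    _ ≤ (∑ m ∈ I, ‖b m‖) ^ 2 := by gcongr; exact norm_sum_le _ _
    _ ≤ I.card * ∑ m ∈ I, ‖b m‖ ^ 2 := sq_sum_le_card_mul_sum_sq
    _ ≤ (N + K) * (K * N + K ^ 2 * E) := by rw [hIcard]; gcongr

end VanDerCorput

section FactorialSum

variable {p : ℕ} [Fact p.Prime]

/-- The summand of the character sum with factorials. -/
noncomputable def factorialTerm (χ : MulChar (ZMod p) ℂ) (f : (ZMod p)[X]) (n : ℕ) : ℂ :=
  χ (n.factorial : ZMod p) * ZMod.stdAddChar (f.eval (n : ZMod p))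

lemma mulChar_mul_conj {χ : MulChar (ZMod p) ℂ} {a : ZMod p} (ha : a ≠ 0) :
    χ a * starRingEnd ℂ (χ a) = 1 := by
  rw [starRingEnd_apply, MulChar.star_apply', ← MulChar.mul_apply, mul_inv_cancel,
    MulChar.one_apply ha.isUnit]

lemma norm_factorialTerm_le_one (χ : MulChar (ZMod p) ℂ) (f : (ZMod p)[X]) (n : ℕ) :
    ‖factorialTerm χ f n‖ ≤ 1 := by
  rw [factorialTerm, norm_mul, AddChar.norm_apply, mul_one]
  by_cases h : (n.factorial : ZMod p) = 0
  · rw [h, MulChar.map_zero, norm_zero]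
    exact zero_le_one
  · have h1 := congrArg norm (mulChar_mul_conj (χ := χ) h)
    rw [norm_mul, Complex.norm_conj, norm_one] at h1
    nlinarith [norm_nonneg (χ (n.factorial : ZMod p))]

lemma factorial_cast_ne_zero {n : ℕ} (hn : n < p) : (n.factorial : ZMod p) ≠ 0 := by
  rw [Ne, ZMod.natCast_eq_zero_iff, (Fact.out : p.Prime).dvd_factorial]
  omega

lemma factorialTerm_add_mul_conj (χ : MulChar (ZMod p) ℂ) (f : (ZMod p)[X]) {n j : ℕ}
    (hn : n < p) (hj : j < p) :
    factorialTerm χ f (n + j) * starRingEnd ℂ (factorialTerm χ f n) =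
      χ (∏ a ∈ (Finset.range j).image (fun i : ℕ => -(1 + i : ZMod p)), ((n : ZMod p) - a)) *
        ZMod.stdAddChar ((f.comp (X + C (j : ZMod p)) - f).eval (n : ZMod p)) := by
  have hinj : Set.InjOn (fun i : ℕ => -(1 + i : ZMod p)) (Finset.range j) := by
    intro i hi k hk h
    simp only [Finset.coe_range, Set.mem_Iio] at hi hk
    have h1 : (i : ZMod p) = k := by simpa using h
    have h2 := congrArg ZMod.val h1
    rwa [ZMod.val_cast_of_lt (by omega), ZMod.val_cast_of_lt (by omega)] at h2
  have hfac : (((n + j).factorial : ℕ) : ZMod p) = n.factorial *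
      ∏ a ∈ (Finset.range j).image (fun i : ℕ => -(1 + i : ZMod p)), ((n : ZMod p) - a) := by
    rw [← Nat.factorial_mul_ascFactorial, Nat.ascFactorial_eq_prod_range, Finset.prod_image hinj]
    push_cast
    congr 1
    refine Finset.prod_congr rfl fun i _ => ?_
    ring
  have h1 := mulChar_mul_conj (χ := χ) (factorial_cast_ne_zero hn)
  rw [factorialTerm, factorialTerm, hfac, map_mul χ, map_mul, ← AddChar.map_neg_eq_conj, eval_sub,
    eval_comp, eval_add, eval_X, eval_C, sub_eq_add_neg, AddChar.map_add_eq_mul]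
  push_cast
  linear_combination (χ (∏ a ∈ (Finset.range j).image (fun i : ℕ => -(1 + i : ZMod p)),
    ((n : ZMod p) - a)) * ZMod.stdAddChar (f.eval ((n : ZMod p) + (j : ZMod p))) *
      ZMod.stdAddChar (-f.eval (n : ZMod p))) * h1

/-- Correlations of the factorial summand. -/
lemma norm_sum_factorialTerm_correlation_le (hp2 : 2 < p) {χ : MulChar (ZMod p) ℂ} (hχ : χ ≠ 1)
    {f : (ZMod p)[X]} {d : ℕ} (hf : f.natDegree ≤ d) (hd : d + 1 < p) {j : ℕ} (hj0 : 0 < j)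
    (hj : j < p) {u v : ℕ} (huv : u ≤ v) (hv : v ≤ p) :
    ‖∑ n ∈ Finset.Ico u v, factorialTerm χ f (n + j) * starRingEnd ℂ (factorialTerm χ f n)‖ ≤
      (j + d + 2 : ℕ) * √p * (2 + Real.log p) := by
  set s := (Finset.range j).image (fun i : ℕ => -(1 + i : ZMod p)) with hs
  have hscard : s.card ≤ j := Finset.card_image_le.trans (Finset.card_range j).le
  have hsne : s.Nonempty := (Finset.nonempty_range_iff.mpr hj0.ne').image _
  set g := f.comp (X + C (j : ZMod p)) - f with hg
  rw [Finset.sum_congr rfl fun n hn => factorialTerm_add_mul_conj χ f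
    ((Finset.mem_Ico.mp hn).2.trans_le hv) hj]
  refine norm_sum_Ico_le_of_complete
    (fun x => χ (∏ a ∈ s, (x - a)) * ZMod.stdAddChar (g.eval x)) (fun a => ?_) huv (by omega)
  have hdeg : (g - C a * X).natDegree ≤ d + 1 := by
    refine (natDegree_sub_le _ _).trans (max_le ((natDegree_sub_le _ _).trans (max_le ?_ ?_)) ?_)
    · rw [natDegree_comp, natDegree_X_add_C]; omega
    · omega
    · exact (natDegree_C_mul_le a X).trans (by rw [natDegree_X]; omega)
  have h1 := norm_sum_mulChar_addChar_le hp2 hχ ZMod.stdAddChar hsne (h := g - C a * X) (by omega)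
  have h2 : ∀ x, χ (∏ a ∈ s, (x - a)) * ZMod.stdAddChar (g.eval x) * ZMod.stdAddChar (-(a * x)) =
      χ (∏ a ∈ s, (x - a)) * ZMod.stdAddChar ((g - C a * X).eval x) := by
    intro x
    rw [mul_assoc, ← AddChar.map_add_eq_mul, ← sub_eq_add_neg]
    simp
  simp_rw [h2]
  refine h1.trans (mul_le_mul_of_nonneg_right ?_ (Real.sqrt_nonneg _))
  exact_mod_cast (by omega : s.card + (g - C a * X).natDegree + 1 ≤ j + d + 2)

/-- The bound for the square of the character sum before optimising the shift length. -/
lemma sq_norm_sum_factorialTerm_le (hp2 : 2 < p) {χ : MulChar (ZMod p) ℂ} (hχ : χ ≠ 1)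
    {f : (ZMod p)[X]} {d : ℕ} (hf : f.natDegree ≤ d) (hd : d + 1 < p) {H N K : ℕ}
    (hN : H + N < p) (hKN : K ≤ N) :
    (K : ℝ) ^ 2 * ‖∑ n ∈ Finset.Icc (H + 1) (H + N), factorialTerm χ f n‖ ^ 2 ≤
      (N + K) * (K * N + K ^ 2 * ((K + d + 2 : ℕ) * √p * (2 + Real.log p))) := by
  set y : ℤ → ℂ := fun n => if n ∈ Finset.Ico (0 : ℤ) N then factorialTerm χ f (H + 1 + n.toNat) else 0
    with hy
  have hlog : 0 ≤ Real.log p := Real.log_natCast_nonneg p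
  have hIco : ∀ (M : ℕ) (g : ℤ → ℂ), ∑ n ∈ Finset.Ico (0 : ℤ) M, g n = ∑ n ∈ Finset.range M, g n := by
    intro M g
    symm
    refine Finset.sum_bij' (fun n _ => (n : ℤ)) (fun n _ => n.toNat) ?_ ?_ ?_ ?_ ?_
    · intro n hn
      rw [Finset.mem_range] at hn
      rw [Finset.mem_Ico]
      omega
    · intro n hn
      rw [Finset.mem_Ico] at hn
      rw [Finset.mem_range]
      omega
    · intro n _
      simp
    · intro n hn
      rw [Finset.mem_Ico] at hn
      omega
    · intro n _
      rfl
  have hyn : ∀ n : ℕ, n < N → y n = factorialTerm χ f (H + 1 + n) := by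
    intro n hn
    simp only [hy]
    rw [if_pos (by rw [Finset.mem_Ico]; omega), Int.toNat_natCast]
  have hsum : ∑ n ∈ Finset.Icc (H + 1) (H + N), factorialTerm χ f n =
      ∑ n ∈ Finset.Ico (0 : ℤ) N, y n := by
    rw [hIco, Finset.sum_congr rfl fun n hn => hyn n (Finset.mem_range.mp hn),
      ← Finset.Ico_add_one_right_eq_Icc, Finset.sum_Ico_eq_sum_range]
    congr 2
    omega
  rw [hsum]
  refine sq_norm_sum_le_of_correlation y (by positivity) (fun n hn => if_neg hn) (fun n => ?_) ?_
  · simp only [hy]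
    split_ifs
    · exact norm_factorialTerm_le_one _ _ _
    · rw [norm_zero]
      exact zero_le_one
  · intro j hj0 hjK
    have h1 : ∑ n ∈ Finset.Ico (0 : ℤ) N, y (n + j) * starRingEnd ℂ (y n) =
        ∑ n ∈ Finset.Ico (H + 1) (H + 1 + (N - j)),
          factorialTerm χ f (n + j) * starRingEnd ℂ (factorialTerm χ f n) := by
      rw [hIco, Finset.sum_Ico_eq_sum_range, Nat.add_sub_cancel_left]
      symm
      refine Finset.sum_subset_zero_on_sdiff (Finset.range_mono (Nat.sub_le N j)) ?_ ?_
      · intro n hn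
        rw [Finset.mem_sdiff, Finset.mem_range, Finset.mem_range] at hn
        have : y (n + j) = 0 := if_neg (by rw [Finset.mem_Ico]; omega)
        rw [this, zero_mul]
      · intro n hn
        rw [Finset.mem_range] at hn
        rw [← Nat.cast_add, hyn _ (by omega), hyn _ (by omega), add_assoc (H + 1)]
    rw [h1]
    refine (norm_sum_factorialTerm_correlation_le hp2 hχ hf hd hj0 (by omega) (by omega)
      (by omega)).trans ?_
    gcongr

end FactorialSum

/-- Optimising the shift length. -/
lemma pow_four_le_of_forall_shift {T A W : ℝ} {N : ℕ} (hA : 0 ≤ A) (hW : 1 ≤ W)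
    (hNW : W ≤ N) (h : ∀ K : ℕ, 0 < K → K ≤ N →
      (K : ℝ) ^ 2 * T ^ 2 ≤ (N + K) * (K * N + K ^ 2 * (A * K * W))) :
    T ^ 4 ≤ 4 * (1 + 2 * A) ^ 2 * (N ^ 3 * W) := by
  have hN1 : (1 : ℝ) ≤ N := hW.trans hNW
  have hW0 : 0 < W := by linarith
  set r := √(N / W) with hr
  have hr1 : 1 ≤ r := Real.one_le_sqrt.mpr ((one_le_div hW0).mpr hNW)
  have hr2 : r ^ 2 = N / W := Real.sq_sqrt (by positivity)
  have hrN : r ≤ N := by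
    rw [hr, Real.sqrt_le_left (by linarith)]
    calc (N : ℝ) / W ≤ N := div_le_self (by linarith) hW
      _ ≤ N ^ 2 := by nlinarith
  set K := ⌈r⌉₊ with hK
  have hKr : r ≤ K := Nat.le_ceil r
  have hK2 : (K : ℝ) ≤ 2 * r := by
    have := Nat.ceil_lt_add_one (by linarith : 0 ≤ r)
    linarith
  have hK0 : 0 < K := Nat.ceil_pos.mpr (by linarith)
  have hKN : K ≤ N := Nat.ceil_le.mpr hrN
  have hKN' : (K : ℝ) ≤ N := by exact_mod_cast hKN
  have hKpos : (0 : ℝ) < K := by exact_mod_cast hK0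
  have h1 : (K : ℝ) * T ^ 2 ≤ 2 * N * (N + K * (A * K * W)) := by
    have := h K hK0 hKN
    have h2 : (K : ℝ) * (K * T ^ 2) ≤ K * (2 * N * (N + K * (A * K * W))) := by
      calc (K : ℝ) * (K * T ^ 2) = K ^ 2 * T ^ 2 := by ring
        _ ≤ (N + K) * (K * N + K ^ 2 * (A * K * W)) := this
        _ ≤ (N + N) * (K * N + K ^ 2 * (A * K * W)) := by gcongr
        _ = K * (2 * N * (N + K * (A * K * W))) := by ring
    exact le_of_mul_le_mul_left h2 hKpos
  have h3 : T ^ 2 ≤ 2 * N * (r * W * (1 + 2 * A)) := by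
    have hNr : (N : ℝ) = r * (r * W) := by
      have : r ^ 2 * W = N := by rw [hr2]; field_simp
      linarith
    have h4 : (K : ℝ) * T ^ 2 ≤ K * (2 * N * (r * W * (1 + 2 * A))) := by
      refine h1.trans ?_
      have h5 : (N : ℝ) ≤ K * (r * W) := by
        conv_lhs => rw [hNr]
        gcongr
      have h6 : (K : ℝ) * (A * K * W) ≤ K * (A * (2 * r) * W) := by gcongr
      calc 2 * N * (N + K * (A * K * W)) ≤ 2 * N * (K * (r * W) + K * (A * (2 * r) * W)) := by gcongr
        _ = K * (2 * N * (r * W * (1 + 2 * A))) := by ring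
    exact le_of_mul_le_mul_left h4 hKpos
  calc T ^ 4 = (T ^ 2) ^ 2 := by ring
    _ ≤ (2 * N * (r * W * (1 + 2 * A))) ^ 2 := by gcongr
    _ = 4 * (1 + 2 * A) ^ 2 * (N ^ 2 * (r ^ 2 * W) * W) := by ring
    _ = 4 * (1 + 2 * A) ^ 2 * (N ^ 3 * W) := by
        rw [hr2, div_mul_cancel₀ _ hW0.ne']
        ring

/-- Theorem 1 (individual character sum bound): for every fixed degree `d`,
there is a constant `C > 0` such that for every odd prime `p`, every polynomial
`f` over `F_p` of degree `d`, every nonprincipal multiplicative character `χ`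
mod `p`, and all `0 ≤ H < H + N < p`,
`|∑_{n=H+1}^{H+N} χ(n!) e_p(f(n))| ≤ C N^{3/4} p^{1/8} (log p)^{1/4}`. -/
theorem char_sum_factorial_individual (d : ℕ) :
    ∃ C : ℝ, 0 < C ∧ ∀ p : ℕ, p.Prime → Odd p →
      ∀ f : Polynomial (ZMod p), f.natDegree = d →
      ∀ χ : MulChar (ZMod p) ℂ, χ ≠ 1 →
      ∀ H N : ℕ, 0 < N → H + N < p →
        ‖∑ n ∈ Finset.Icc (H + 1) (H + N),
            χ ((n.factorial : ZMod p)) *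
              Complex.exp (2 * Real.pi * Complex.I *
                (((f.eval (n : ZMod p)).val : ℂ)) / (p : ℂ))‖ ≤
          C * (N : ℝ) ^ ((3 : ℝ) / 4) * (p : ℝ) ^ ((1 : ℝ) / 8) *
            (Real.log p) ^ ((1 : ℝ) / 4) := by
  set A : ℝ := 3 * (d + 3) with hA
  set c : ℝ := 4 * (1 + 2 * A) ^ 2 + (d + 2) with hc
  have hA0 : 0 ≤ A := by positivity
  have hc0 : 0 < c := by positivity
  refine ⟨c ^ ((1 : ℝ) / 4), by positivity, ?_⟩
  intro p hp hodd f hf χ hχ H N hN hHN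
  have _ : Fact p.Prime := ⟨hp⟩
  have hp2 : 2 < p := by
    rcases hp.two_le.lt_or_eq with h | rfl
    · exact h
    · exact absurd hodd (by decide)
  have hsum : ∑ n ∈ Finset.Icc (H + 1) (H + N), χ ((n.factorial : ZMod p)) *
      Complex.exp (2 * Real.pi * Complex.I * (((f.eval (n : ZMod p)).val : ℂ)) / (p : ℂ)) =
      ∑ n ∈ Finset.Icc (H + 1) (H + N), factorialTerm χ f n := by
    refine Finset.sum_congr rfl fun n _ => ?_
    rw [factorialTerm, ZMod.stdAddChar_apply, ZMod.toCircle_apply]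
  rw [hsum]
  set T := ‖∑ n ∈ Finset.Icc (H + 1) (H + N), factorialTerm χ f n‖ with hT
  have hT0 : 0 ≤ T := norm_nonneg _
  have hTN : T ≤ N := by
    refine (norm_sum_le_of_le _ fun n _ => norm_factorialTerm_le_one χ f n).trans ?_
    simp
  have hp1 : (1 : ℝ) ≤ p := by exact_mod_cast hp.one_le
  have hsqrt : 1 ≤ √(p : ℝ) := Real.one_le_sqrt.mpr hp1
  have hlog : 1 ≤ Real.log p := by
    rw [Real.le_log_iff_exp_le (by linarith)]
    refine Real.exp_one_lt_three.le.trans ?_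
    exact_mod_cast hp2
  set W := √(p : ℝ) * Real.log p with hW
  have hW1 : 1 ≤ W := one_le_mul_of_one_le_of_one_le hsqrt hlog
  have hN0 : (0 : ℝ) ≤ N := N.cast_nonneg
  have hN1 : (1 : ℝ) ≤ N := by exact_mod_cast hN
  have hTN4 : T ^ 4 ≤ N ^ 3 * N := by
    rw [← pow_succ]
    exact pow_le_pow_left₀ hT0 hTN 4
  have key : T ^ 4 ≤ c * (N ^ 3 * W) := by
    have hpos : 0 ≤ (N : ℝ) ^ 3 * W := by positivity
    rcases le_or_gt p (d + 1) with hd | hd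
    · have hNd : (N : ℝ) ≤ d + 2 := by exact_mod_cast (by omega : N ≤ d + 2)
      calc T ^ 4 ≤ N ^ 3 * N := hTN4
        _ ≤ N ^ 3 * ((d + 2) * W) := by
            gcongr
            exact hNd.trans (le_mul_of_one_le_right (by positivity) hW1)
        _ = (d + 2) * (N ^ 3 * W) := by ring
        _ ≤ c * (N ^ 3 * W) := by
            gcongr
            exact le_add_of_nonneg_left (by positivity)
    · rcases le_total W N with hNW | hNW
      · refine (pow_four_le_of_forall_shift hA0 hW1 hNW fun K hK hKN => ?_).trans ?_
        · refine (sq_norm_sum_factorialTerm_le hp2 hχ hf.le hd hHN hKN).trans ?_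
          gcongr (N + K : ℝ) * (K * N + K ^ 2 * ?_)
          have hK1 : (1 : ℝ) ≤ K := by exact_mod_cast hK
          have h1 : ((K + d + 2 : ℕ) : ℝ) ≤ (d + 3) * K := by
            push_cast
            nlinarith [(d.cast_nonneg : (0 : ℝ) ≤ d)]
          calc ((K + d + 2 : ℕ) : ℝ) * √p * (2 + Real.log p)
              ≤ (d + 3) * K * √p * (3 * Real.log p) := by
                gcongr
                linarith
            _ = A * K * W := by rw [hA, hW]; ring
        · gcongr
          exact le_add_of_nonneg_right (by positivity)
      · calc T ^ 4 ≤ N ^ 3 * N := hTN4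
          _ ≤ N ^ 3 * W := by gcongr
          _ ≤ c * (N ^ 3 * W) := by
              refine le_mul_of_one_le_left hpos ?_
              nlinarith [sq_nonneg (1 + 2 * A), (d.cast_nonneg : (0 : ℝ) ≤ d)]
  have hroot : T ≤ (c * (N ^ 3 * W)) ^ ((1 : ℝ) / 4) := by
    have h1 := Real.rpow_le_rpow (by positivity) key (by norm_num : (0 : ℝ) ≤ 1 / 4)
    rwa [← Real.rpow_natCast, ← Real.rpow_mul hT0, show ((4 : ℕ) : ℝ) * (1 / 4) = 1 by norm_num,
      Real.rpow_one] at h1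
  refine hroot.trans (le_of_eq ?_)
  have hp0 : (0 : ℝ) ≤ p := by linarith
  have hlog0 : 0 ≤ Real.log p := by linarith
  rw [Real.mul_rpow hc0.le (by positivity), hW, Real.mul_rpow (by positivity) (by positivity),
    Real.mul_rpow (by positivity) hlog0, Real.sqrt_eq_rpow, ← Real.rpow_mul hp0,
    ← Real.rpow_natCast, ← Real.rpow_mul hN0]
  norm_num
  ring
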